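/- arXiv:2402.08247 — 4 statements merged into one kernel-verified Lean document; each statement's English description precedes it below -/
import Mathlib

section
/- Every left-c.e. real whose binary expansion is not eventually constant, viewed as a subset of ℕ, is enumeration reducible to its complement. -/
open MeasureTheory

/-- A set (of any primcodable type) is computably enumerable. -/
def CE {α : Type*} [Primcodable α] (S : Set α) : Prop :=
  ∃ f : α →. ℕ, Partrec f ∧ S = f.Dom

/-- The `y`-th finite set in a canonical listing of all finite subsets of `ℕ`. -/
def Dfin (y : ℕ) : Set ℕ := ↑(Denumerable.ofNat (Finset ℕ) y)

/-- Application of the enumeration operator with c.e. index set `W` to an oracle `X`. -/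
def enumOp (W : Set ℕ) (X : Set ℕ) : Set ℕ :=
  {x | ∃ y, Nat.pair x y ∈ W ∧ Dfin y ⊆ X}

/-- Enumeration reducibility. -/
def EnumRed (A B : Set ℕ) : Prop := ∃ W : Set ℕ, CE W ∧ A = enumOp W B

/-- Enumeration equivalence. -/
def EnumEquiv (A B : Set ℕ) : Prop := EnumRed A B ∧ EnumRed B A

/-- Application of a hyper-enumeration operator with c.e. index set `W` to an oracle `X`. -/
def henumOp (W : Set ℕ) (X : Set ℕ) : Set ℕ :=
  {x | ∀ f : List ℕ, ∃ n y,
    Nat.pair (Encodable.encode (f.take n)) (Nat.pair x y) ∈ W ∧ Dfin y ⊆ X}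

/-- Hyper-enumeration reducibility. -/
def HypEnumRed (B A : Set ℕ) : Prop := ∃ W : Set ℕ, CE W ∧ B = henumOp W A

def Cototal (A : Set ℕ) : Prop := EnumRed A Aᶜ

def HypCototal (A : Set ℕ) : Prop := HypEnumRed A Aᶜ

def UnifIntroenum (X : Set ℕ) : Prop :=
  X.Infinite ∧ ∃ W : Set ℕ, CE W ∧ ∀ Y ⊆ X, Y.Infinite → enumOp W Y = X

def Introenum (X : Set ℕ) : Prop :=
  X.Infinite ∧ ∀ Y ⊆ X, Y.Infinite → ∃ W : Set ℕ, CE W ∧ enumOp W Y = X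

/-- View a point of Cantor space as a subset of `ℕ`. -/
def toSet (A : ℕ → Bool) : Set ℕ := {n | A n = true}

/-- Remove `n` from (the set coded by) `A`. -/
def drop (A : ℕ → Bool) (n : ℕ) : ℕ → Bool := fun m => if m = n then false else A m

/-- `A` is `Ψ`-autoreducible. -/
def AutoRed (Ψ : ℕ → (ℕ → Bool) → Bool) (A : ℕ → Bool) : Prop :=
  ∀ n, A n = Ψ n (drop A n)

/-- The basic clopen cylinder of a finite binary string. -/
def cyl (σ : List Bool) : Set (ℕ → Bool) := {A | ∀ i : Fin σ.length, A i = σ.get i}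

/-- `μ` is the uniform (fair-coin) measure on Cantor space: it gives each cylinder
of a string of length `k` measure `2⁻ᵏ`.  (This characterizes the measure uniquely.) -/
def IsCoinMeasure (μ : Measure (ℕ → Bool)) : Prop :=
  ∀ σ : List Bool, μ (cyl σ) = 2⁻¹ ^ σ.length

/-- The first `k` bits of `A`. -/
def res (A : ℕ → Bool) (k : ℕ) : List Bool := List.ofFn fun i : Fin k => A i

/-- A `Π⁰₂` class in Cantor space. -/
def IsPi02 (C : Set (ℕ → Bool)) : Prop :=
  ∃ R : ℕ → List Bool → Bool, Computable (fun p : ℕ × List Bool => R p.1 p.2) ∧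
    C = {A | ∀ m, ∃ k, R m (res A k) = true}

/-- A `Π⁰₃` class in Cantor space. -/
def IsPi03 (C : Set (ℕ → Bool)) : Prop :=
  ∃ R : ℕ → ℕ → List Bool → Bool,
    Computable (fun p : ℕ × ℕ × List Bool => R p.1 p.2.1 p.2.2) ∧
    C = {A | ∀ m, ∃ k, ∀ j, R m k (res A j) = true}

/-- The `m`-th level of the open test determined by the c.e. set `W` of pairs. -/
def testSet (W : Set (ℕ × List Bool)) (m : ℕ) : Set (ℕ → Bool) :=
  ⋃ σ ∈ {σ | (m, σ) ∈ W}, cyl σ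

/-- Martin-Löf randomness (with respect to a measure `μ` on Cantor space). -/
def MLRandom (μ : Measure (ℕ → Bool)) (A : ℕ → Bool) : Prop :=
  ∀ W : Set (ℕ × List Bool), CE W →
    (∀ m, μ (testSet W m) ≤ 2⁻¹ ^ m) → ∃ m, A ∉ testSet W m

/-- 2-randomness: passing all uniformly `Σ⁰₂` tests. -/
def TwoRandom (μ : Measure (ℕ → Bool)) (A : ℕ → Bool) : Prop :=
  ∀ R : ℕ → ℕ → List Bool → Bool,
    Computable (fun p : ℕ × ℕ × List Bool => R p.1 p.2.1 p.2.2) →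
    (∀ m, μ {A | ∃ k, ∀ j, R m k (res A j) = true} ≤ 2⁻¹ ^ m) →
    ∃ m, A ∉ {A | ∃ k, ∀ j, R m k (res A j) = true}

/-- Weak 2-randomness: avoiding every null `Π⁰₂` class. -/
def Weak2Random (μ : Measure (ℕ → Bool)) (A : ℕ → Bool) : Prop :=
  ∀ C : Set (ℕ → Bool), IsPi02 C → μ C = 0 → A ∉ C

/-- Weak 3-randomness: avoiding every null `Π⁰₃` class. -/
def Weak3Random (μ : Measure (ℕ → Bool)) (A : ℕ → Bool) : Prop :=
  ∀ C : Set (ℕ → Bool), IsPi03 C → μ C = 0 → A ∉ C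

/-- Base code of a rational. -/
def e0 (r : ℚ) : ℕ := Nat.pair (Encodable.encode r.num) r.den

/-- The code of a rational. -/
def encQ (r : ℚ) : ℕ := @Encodable.encode ℚ (Rat.instDenumerable.toEncodable) r

theorem enc_rat (r : ℚ) : encQ r =
    (List.range (e0 r)).countP
      (fun k => @decide _ (@Encodable.decidableRangeEncode ℚ Rat.instEncodable k)) := by
  rfl

theorem enc_int_nonneg (a : ℕ) : Encodable.encode (a : ℤ) = 2 * a := by
  rfl

theorem enc_int_neg (a : ℕ) : Encodable.encode (Int.negSucc a) = 2 * a + 1 := by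
  rfl

theorem enc_int_natAbs (a : ℤ) : (Encodable.encode a + 1) / 2 = a.natAbs := by
  cases a with
  | ofNat a => have := enc_int_nonneg a; simp at *; omega
  | negSucc a => rw [enc_int_neg]; simp; omega

/-- Coprimality, as a bounded quantifier. -/
def Cop (x y : ℕ) : Prop := 0 < y ∧ ∀ d < y + 1, (x % d = 0 ∧ y % d = 0) → d = 1

theorem cop_iff (x y : ℕ) : Cop x y ↔ 0 < y ∧ x.Coprime y := by
  unfold Cop
  refine and_congr_right fun hy => ⟨fun h => ?_, fun h d _ ⟨h1, h2⟩ => ?_⟩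
  · refine h (x.gcd y) ?_ ⟨?_, ?_⟩
    · exact Nat.lt_succ_of_le (Nat.gcd_le_right _ hy)
    · exact Nat.mod_eq_zero_of_dvd (Nat.gcd_dvd_left _ _)
    · exact Nat.mod_eq_zero_of_dvd (Nat.gcd_dvd_right _ _)
  · exact Nat.eq_one_of_dvd_coprimes h (Nat.dvd_of_mod_eq_zero h1) (Nat.dvd_of_mod_eq_zero h2)

theorem cop_primrec : PrimrecRel Cop := by
  have h1 : PrimrecRel (fun (d : ℕ) (p : ℕ × ℕ) => (p.1 % d = 0 ∧ p.2 % d = 0) → d = 1) := by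
    have hx : Primrec (fun z : ℕ × (ℕ × ℕ) => z.2.1 % z.1) :=
      Primrec.nat_mod.comp (Primrec.fst.comp Primrec.snd) Primrec.fst
    have hy : Primrec (fun z : ℕ × (ℕ × ℕ) => z.2.2 % z.1) :=
      Primrec.nat_mod.comp (Primrec.snd.comp Primrec.snd) Primrec.fst
    have ha : PrimrecPred (fun z : ℕ × (ℕ × ℕ) => z.2.1 % z.1 = 0) :=
      Primrec.eq.comp hx (Primrec.const 0)
    have hb : PrimrecPred (fun z : ℕ × (ℕ × ℕ) => z.2.2 % z.1 = 0) :=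
      Primrec.eq.comp hy (Primrec.const 0)
    have hc : PrimrecPred (fun z : ℕ × (ℕ × ℕ) => z.1 = 1) :=
      Primrec.eq.comp Primrec.fst (Primrec.const 1)
    refine PrimrecPred.of_eq ((ha.and hb).not.or hc) fun z => ?_
    tauto
  have h2 := h1.forall_mem_list
  have h3 : PrimrecPred (fun p : ℕ × ℕ => ∀ d ∈ List.range (p.2 + 1),
      (p.1 % d = 0 ∧ p.2 % d = 0) → d = 1) :=
    h2.comp (Primrec.list_range.comp (Primrec.succ.comp Primrec.snd)) Primrec.id
  have h4 : PrimrecPred (fun p : ℕ × ℕ => 0 < p.2) :=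
    Primrec.nat_lt.comp (Primrec.const 0) Primrec.snd
  refine PrimrecPred.of_eq (h4.and h3) fun z => ?_
  simp only [Cop, List.mem_range]

/-- The codes of rationals. -/
def Val (k : ℕ) : Prop := Cop ((k.unpair.1 + 1) / 2) k.unpair.2

theorem val_primrec : PrimrecPred Val :=
  cop_primrec.comp
    (Primrec.nat_div.comp (Primrec.succ.comp (Primrec.fst.comp Primrec.unpair)) (Primrec.const 2))
    (Primrec.snd.comp Primrec.unpair)

theorem val_iff (k : ℕ) : Val k ↔ k ∈ Set.range e0 := by
  unfold Val
  rw [cop_iff]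
  constructor
  · rintro ⟨h1, h2⟩
    have h3 := enc_int_natAbs (Denumerable.ofNat ℤ k.unpair.1)
    have h4 : Encodable.encode (Denumerable.ofNat ℤ k.unpair.1) = k.unpair.1 :=
      Denumerable.encode_ofNat _
    have h4' : @Encodable.encode ℤ Int.encodable (Denumerable.ofNat ℤ k.unpair.1)
      = k.unpair.1 := h4
    refine ⟨⟨Denumerable.ofNat ℤ k.unpair.1, k.unpair.2, h1.ne', ?_⟩, ?_⟩
    · rw [← h3, h4']; exact h2
    · simp only [e0]
      rw [h4', Nat.pair_unpair]
  · rintro ⟨r, rfl⟩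
    simp only [e0, Nat.unpair_pair, enc_int_natAbs]
    exact ⟨r.pos, r.reduced⟩

open Classical in
/-- Rank of a code. -/
noncomputable def rk (k : ℕ) : ℕ := ((List.range k).filter (fun j => decide (Val j))).length

theorem rk_primrec : Primrec rk := by
  classical
  unfold rk
  exact Primrec.list_length.comp ((Primrec.listFilter val_primrec).comp Primrec.list_range)

theorem enc_rat_rk (r : ℚ) : encQ r = rk (e0 r) := by
  refine (enc_rat r).trans ?_
  rw [rk, List.countP_eq_length_filter]
  congr 2
  funext k
  rw [decide_eq_decide, val_iff]
  rfl

theorem rk_lt {k l : ℕ} (hk : Val k) (h : k < l) : rk k < rk l := by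
  classical
  have hmono : ∀ m, rk m ≤ rk (m + 1) := fun m => by
    simp only [rk, List.range_succ, List.filter_append, List.length_append]; omega
  have h1 : rk (k + 1) = rk k + 1 := by
    simp [rk, List.range_succ, List.filter_append, hk]
  have h2 : rk (k + 1) ≤ rk l := monotone_nat_of_le_succ hmono h
  omega

theorem rk_inj {k l : ℕ} (hk : Val k) (hl : Val l) (h : rk k = rk l) : k = l := by
  rcases lt_trichotomy k l with h1 | h1 | h1
  · have := rk_lt hk h1; omega
  · exact h1
  · have := rk_lt hl h1; omega

theorem rat_of_rk (r : ℚ) (a d : ℕ) (hc : Cop a d) (h : rk (Nat.pair (2 * a) d) = encQ r) :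
    r = a / d := by
  have hv : Val (Nat.pair (2 * a) d) := by
    unfold Val
    simp only [Nat.unpair_pair]
    rwa [show (2 * a + 1) / 2 = a by omega]
  have h2 : Nat.pair (2 * a) d = e0 r :=
    rk_inj hv ((val_iff _).2 ⟨r, rfl⟩) (h.trans (enc_rat_rk r))
  unfold e0 at h2
  rw [Nat.pair_eq_pair, ← enc_int_nonneg] at h2
  have h3 := Encodable.encode_injective h2.1
  conv_lhs => rw [← Rat.num_div_den r, ← h3, ← h2.2]
  simp

theorem rk_of_rat (r : ℚ) (hr : 0 ≤ r) : ∃ a d : ℕ, Cop a d ∧ 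
    rk (Nat.pair (2 * a) d) = encQ r := by
  refine ⟨r.num.natAbs, r.den, ?_, ?_⟩
  · rw [cop_iff]; exact ⟨r.pos, r.reduced⟩
  · rw [enc_rat_rk, e0, ← enc_int_nonneg, Int.natAbs_of_nonneg (Rat.num_nonneg.2 hr)]

theorem mem_raise (i : ℕ) (l : List ℕ) : ∀ (n : ℕ) (b : Bool),
    (l.foldl (fun (st : ℕ × Bool) m => (m + st.1 + 1, st.2 || decide (i = m + st.1))) (n,b)).2
      = (b || decide (i ∈ Denumerable.raise' l n)) := by
  induction l with
  | nil => intro n b; simp [Denumerable.raise']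
  | cons m l ih => intro n b; simp [Denumerable.raise', ih, Bool.or_assoc]

theorem mem_fin (i y : ℕ) : i ∈ Denumerable.ofNat (Finset ℕ) y ↔
    i ∈ Denumerable.raise' (Denumerable.ofNat (List ℕ) y) 0 := by
  have : Denumerable.ofNat (Finset ℕ) y = Finset.map (Denumerable.eqv ℕ).symm.toEmbedding
      (Denumerable.raise'Finset (Denumerable.ofNat (List ℕ) y) 0) := by
    rfl
  rw [this]
  simp [Denumerable.raise'Finset]
  rfl

/-- Membership in a canonical finite set. -/
def memD (i y : ℕ) : Bool := decide (i ∈ Denumerable.ofNat (Finset ℕ) y)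

theorem memD_primrec : Primrec₂ memD := by
  have hst : Primrec (fun z : (ℕ × ℕ) × ((ℕ × Bool) × ℕ) => z.2.2 + z.2.1.1) :=
    Primrec.nat_add.comp (Primrec.snd.comp Primrec.snd)
      (Primrec.fst.comp (Primrec.fst.comp Primrec.snd))
  have hd : Primrec (fun z : (ℕ × ℕ) × ((ℕ × Bool) × ℕ) => decide (z.1.1 = z.2.2 + z.2.1.1)) :=
    PrimrecPred.decide (Primrec.eq.comp (Primrec.fst.comp Primrec.fst) hst)
  have hb : Primrec (fun z : (ℕ × ℕ) × ((ℕ × Bool) × ℕ) =>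
      (z.2.1.2 || decide (z.1.1 = z.2.2 + z.2.1.1))) :=
    Primrec.or.comp (Primrec.snd.comp (Primrec.fst.comp Primrec.snd)) hd
  have h := Primrec.list_foldl (α := ℕ × ℕ) (f := fun p => Denumerable.ofNat (List ℕ) p.2)
    (g := fun _ => ((0 : ℕ), false))
    (h := fun p z => (z.2 + z.1.1 + 1, (z.1.2 || decide (p.1 = z.2 + z.1.1))))
    ((Primrec.ofNat (List ℕ)).comp Primrec.snd) (Primrec.const _)
    (Primrec.pair (Primrec.succ.comp hst) hb)
  refine (Primrec.snd.comp h).of_eq fun p => ?_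
  rw [mem_raise]
  simp only [memD, Bool.false_or, decide_eq_decide]
  exact (mem_fin _ _).symm

/-- Numerator of the dyadic whose first `n` bits are the complement of `Dfin y`. -/
def NN (y : ℕ) (n : ℕ) : ℕ := Nat.rec 0 (fun i IH => 2 * IH + cond (memD i y) 0 1) n

theorem NN_succ (y n : ℕ) : NN y (n + 1) = 2 * NN y n + cond (memD n y) 0 1 := rfl

theorem NN_primrec : Primrec₂ NN := by
  refine Primrec.nat_rec' (α := ℕ × ℕ) (f := fun p => p.2) (g := fun _ => (0 : ℕ))
    (h := fun p z => 2 * z.2 + cond (memD z.1 p.1) 0 1) Primrec.snd (Primrec.const 0) ?_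
  refine Primrec.nat_add.comp (Primrec.nat_mul.comp (Primrec.const 2)
    (Primrec.snd.comp Primrec.snd)) ?_
  exact Primrec.cond (memD_primrec.comp (Primrec.fst.comp Primrec.snd)
    (Primrec.fst.comp Primrec.fst)) (Primrec.const 0) (Primrec.const 1)

theorem pow_primrec : Primrec (fun n : ℕ => 2 ^ n) := by
  refine (Primrec.nat_rec₁ (f := fun _ IH => 2 * IH) 1
    (Primrec.nat_mul.comp (Primrec.const 2) Primrec.snd)).of_eq fun n => ?_
  induction n with
  | zero => rfl
  | succ n ih => rw [pow_succ, ← ih]; simp [mul_comm]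

/-- The primitive recursive matrix: arguments `n, y, c, a, d`. -/
def Mat (n y c a d : ℕ) : Prop :=
  Cop a d ∧ rk (Nat.pair (2 * a) d) = c ∧ d * (2 * NN y n + 1) < a * 2 ^ (n + 1)

theorem mat_primrec : PrimrecPred (fun z : (ℕ × ℕ) × (ℕ × (ℕ × ℕ)) =>
    Mat z.1.1 z.1.2 z.2.1 z.2.2.1 z.2.2.2) := by
  have pn : Primrec (fun z : (ℕ × ℕ) × (ℕ × (ℕ × ℕ)) => z.1.1) := Primrec.fst.comp Primrec.fst
  have py : Primrec (fun z : (ℕ × ℕ) × (ℕ × (ℕ × ℕ)) => z.1.2) := Primrec.snd.comp Primrec.fst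
  have pc : Primrec (fun z : (ℕ × ℕ) × (ℕ × (ℕ × ℕ)) => z.2.1) := Primrec.fst.comp Primrec.snd
  have pa : Primrec (fun z : (ℕ × ℕ) × (ℕ × (ℕ × ℕ)) => z.2.2.1) :=
    Primrec.fst.comp (Primrec.snd.comp Primrec.snd)
  have pd : Primrec (fun z : (ℕ × ℕ) × (ℕ × (ℕ × ℕ)) => z.2.2.2) :=
    Primrec.snd.comp (Primrec.snd.comp Primrec.snd)
  have h1 := cop_primrec.comp pa pd
  have h2 := Primrec.eq.comp (rk_primrec.comp (Primrec₂.natPair.comp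
    (Primrec.nat_mul.comp (Primrec.const 2) pa) pd)) pc
  have h3 := Primrec.nat_lt.comp (Primrec.nat_mul.comp pd (Primrec.succ.comp
    (Primrec.nat_mul.comp (Primrec.const 2) (NN_primrec.comp py pn))))
    (Primrec.nat_mul.comp pa (pow_primrec.comp (Primrec.succ.comp pn)))
  exact (h1.and (h2.and h3))

theorem ce_of_exists (g : ℕ × ℕ → Bool) (h : Computable g) :
    CE {x : ℕ | ∃ e : ℕ, g (x, e) = true} := by
  refine ⟨fun x => Nat.rfind (fun e => Part.some (g (x, e))), ?_, ?_⟩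
  · exact Partrec.rfind (p := fun x e => Part.some (g (x, e))) h.to₂.partrec₂
  · ext x
    refine Iff.trans ?_ (Nat.rfind_dom (p := fun e => Part.some (g (x, e)))).symm
    simp

/-- The arguments of the matrix. -/
def args (c : ℕ → ℕ) (z : ℕ × ℕ) : (ℕ × ℕ) × (ℕ × (ℕ × ℕ)) :=
  (z.1.unpair, (c z.2.unpair.1, z.2.unpair.2.unpair))

theorem args_computable (c : ℕ → ℕ) (hc : Computable c) : Computable (args c) := by
  have ue : Computable (fun z : ℕ × ℕ => z.2.unpair) := Computable.unpair.comp Computable.snd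
  have hc : Computable (fun z : ℕ × ℕ => c z.2.unpair.1) :=
    hc.comp (Computable.fst.comp ue)
  exact Computable.pair (Computable.unpair.comp Computable.fst)
      (Computable.pair hc (Computable.unpair.comp (Computable.snd.comp ue)))

theorem mat_bool : ∃ g : (ℕ × ℕ) × (ℕ × (ℕ × ℕ)) → Bool, Computable g ∧
    ∀ z, g z = true ↔ Mat z.1.1 z.1.2 z.2.1 z.2.2.1 z.2.2.2 := by
  obtain ⟨i, h⟩ := mat_primrec
  exact ⟨_, h.to_comp, fun z => decide_eq_true_iff⟩

theorem W_ce (c : ℕ → ℕ) (hc : Computable c) :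
    CE {x : ℕ | ∃ e : ℕ, Mat x.unpair.1 x.unpair.2 (c e.unpair.1)
      e.unpair.2.unpair.1 e.unpair.2.unpair.2} := by
  obtain ⟨g, hg, hg2⟩ := mat_bool
  have h := ce_of_exists (fun z => g (args c z)) (hg.comp (args_computable c hc))
  simp only [hg2] at h
  exact h

theorem computable_encQ (q : ℕ → ℚ) (hq : Computable q) : Computable (fun s => encQ (q s)) :=
  Computable.encode.comp hq

theorem NN_real (y n : ℕ) : (NN y n : ℝ) / 2 ^ n =
    ∑ i ∈ Finset.range n, Set.indicator (Dfin y)ᶜ (fun n => (2:ℝ)⁻¹ ^ (n + 1)) i := by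
  induction n with
  | zero => simp [NN]
  | succ n ih =>
    rw [Finset.sum_range_succ, ← ih, NN_succ]
    by_cases h : n ∈ Denumerable.ofNat (Finset ℕ) y
    · have h2 : n ∉ (Dfin y)ᶜ := by simpa [Dfin] using h
      rw [Set.indicator_of_notMem h2]
      simp [memD, h]
      field_simp
      ring
    · have h2 : n ∈ (Dfin y)ᶜ := by simpa [Dfin] using h
      rw [Set.indicator_of_mem h2]
      simp [memD, h]
      field_simp
      ring

theorem summ (A : Set ℕ) : Summable (Set.indicator A (fun n => (2:ℝ)⁻¹ ^ (n + 1))) := by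
  refine Summable.indicator ?_ A
  exact (summable_nat_add_iff 1).2 (summable_geometric_of_lt_one (by norm_num) (by norm_num))

theorem ind_nonneg (A : Set ℕ) (i : ℕ) :
    0 ≤ Set.indicator A (fun n => (2:ℝ)⁻¹ ^ (n + 1)) i :=
  Set.indicator_nonneg (fun _ _ => by positivity) i

theorem upper (A : Set ℕ) (n : ℕ) (hn : n ∉ A) :
    ∑' n, Set.indicator A (fun n => (2:ℝ)⁻¹ ^ (n + 1)) n ≤
      ∑ i ∈ Finset.range n, Set.indicator A (fun n => (2:ℝ)⁻¹ ^ (n + 1)) i + (2:ℝ)⁻¹ ^ (n + 1) := by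
  rw [← (summ A).sum_add_tsum_nat_add (n + 1), Finset.sum_range_succ,
    Set.indicator_of_notMem hn, add_zero]
  gcongr
  have hs : HasSum (fun i : ℕ => (2:ℝ)⁻¹ ^ (i + (n + 1) + 1)) ((2:ℝ)⁻¹ ^ (n + 1)) := by
    have := (hasSum_geometric_of_lt_one (r := (2:ℝ)⁻¹) (by norm_num) (by norm_num)).mul_left
      ((2:ℝ)⁻¹ ^ (n + 2))
    have h1 : (fun i : ℕ => (2:ℝ)⁻¹ ^ (i + (n + 1) + 1)) =
        fun i => (2:ℝ)⁻¹ ^ (n + 2) * (2:ℝ)⁻¹ ^ i := by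
      funext i; rw [← pow_add]; congr 1; ring
    have h2 : (2:ℝ)⁻¹ ^ (n + 1) = (2:ℝ)⁻¹ ^ (n + 2) * (1 - (2:ℝ)⁻¹)⁻¹ := by
      rw [pow_succ _ (n + 1), mul_assoc]; norm_num
    rw [h1, h2]; exact this
  rw [← hs.tsum_eq]
  refine Summable.tsum_le_tsum (fun i => ?_) ((summable_nat_add_iff (n + 1)).2 (summ A)) hs.summable
  exact Set.indicator_le_self' (fun _ _ => by positivity) _

theorem lower (A : Set ℕ) (n : ℕ) (hn : n ∈ A) (hA : A.Infinite) :
    ∑ i ∈ Finset.range n, Set.indicator A (fun n => (2:ℝ)⁻¹ ^ (n + 1)) i + (2:ℝ)⁻¹ ^ (n + 1) <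
    ∑' n, Set.indicator A (fun n => (2:ℝ)⁻¹ ^ (n + 1)) n := by
  obtain ⟨m, hm, hmn⟩ := hA.exists_gt n
  have h1 : ∑ i ∈ Finset.range (m + 1), Set.indicator A (fun n => (2:ℝ)⁻¹ ^ (n + 1)) i ≤
      ∑' n, Set.indicator A (fun n => (2:ℝ)⁻¹ ^ (n + 1)) n :=
    (summ A).sum_le_tsum _ fun i _ => ind_nonneg A i
  refine lt_of_lt_of_le ?_ h1
  have h2 : ∑ i ∈ Finset.range (n + 1), Set.indicator A (fun n => (2:ℝ)⁻¹ ^ (n + 1)) i ≤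
      ∑ i ∈ Finset.range m, Set.indicator A (fun n => (2:ℝ)⁻¹ ^ (n + 1)) i :=
    Finset.sum_le_sum_of_subset_of_nonneg (Finset.range_subset_range.2 hmn)
      fun i _ _ => ind_nonneg A i
  rw [Finset.sum_range_succ, Set.indicator_of_mem hn] at h2
  rw [Finset.sum_range_succ, Set.indicator_of_mem hm]
  have : (0:ℝ) < (2:ℝ)⁻¹ ^ (m + 1) := by positivity
  linarith

theorem mat_ineq (y n a d : ℕ) (hd : 0 < d) : d * (2 * NN y n + 1) < a * 2 ^ (n + 1) ↔
    ∑ i ∈ Finset.range n, Set.indicator (Dfin y)ᶜ (fun n => (2:ℝ)⁻¹ ^ (n + 1)) i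
      + (2:ℝ)⁻¹ ^ (n + 1) < (a : ℝ) / d := by
  rw [← NN_real]
  have h : (NN y n : ℝ) / 2 ^ n + (2:ℝ)⁻¹ ^ (n + 1) = (2 * NN y n + 1) / 2 ^ (n + 1) := by
    rw [inv_pow]; field_simp; ring
  have hd' : (0:ℝ) < d := by exact_mod_cast hd
  rw [h, div_lt_div_iff₀ (by positivity) hd', mul_comm]
  exact_mod_cast Iff.rfl

/-- Every left-c.e. real whose binary expansion is not eventually constant, viewed
as a set of natural numbers, is enumeration reducible to its complement. -/
theorem stmt_13 (α : ℝ) (A : Set ℕ)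
    (hbits : α = ∑' n, Set.indicator A (fun n => (2:ℝ)⁻¹ ^ (n + 1)) n)
    (hlce : ∃ q : ℕ → ℚ, Computable q ∧ Monotone q ∧
      Filter.Tendsto (fun n => ((q n : ℝ))) Filter.atTop (nhds α))
    (hA : A.Infinite) (hAc : Aᶜ.Infinite) :
    EnumRed A Aᶜ := by
  obtain ⟨q, hq, hmono, hlim⟩ := hlce
  refine ⟨_, W_ce (fun s => encQ (q s)) (computable_encQ q hq), ?_⟩
  ext n
  simp only [enumOp, Set.mem_ofPred_eq, Nat.unpair_pair]
  constructor
  · intro hn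
    have hlow := lower A n hn hA
    rw [← hbits] at hlow
    obtain ⟨s, hs⟩ := (Filter.Tendsto.eventually_const_lt hlow hlim).exists
    classical
    have hpos : (0:ℝ) ≤ q s := by
      refine le_trans ?_ hs.le
      have := Finset.sum_nonneg (s := Finset.range n) fun i _ => ind_nonneg A i
      positivity
    obtain ⟨a, d, hc, hk⟩ := rk_of_rat (q s) (by exact_mod_cast hpos)
    let F : Finset ℕ := (Finset.range n).filter (· ∉ A)
    obtain ⟨y, hy⟩ : ∃ y, Denumerable.ofNat (Finset ℕ) y = F := ⟨_, Denumerable.ofNat_encode F⟩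
    have hF : Dfin y = (F : Set ℕ) := by
      rw [Dfin, hy]
    refine ⟨y, ⟨Nat.pair s (Nat.pair a d), ?_⟩, ?_⟩
    · simp only [Nat.unpair_pair]
      refine ⟨hc, hk, ?_⟩
      rw [mat_ineq _ _ _ _ hc.1]
      have h1 := rat_of_rk _ _ _ hc hk
      have h2 : (q s : ℝ) = a / d := by rw [h1]; push_cast; rfl
      rw [← h2]
      refine lt_of_eq_of_lt ?_ hs
      congr 1
      refine Finset.sum_congr rfl fun i hi => ?_
      have : i ∈ (Dfin y)ᶜ ↔ i ∈ A := by
        rw [hF]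
        simp [F, Finset.mem_range.1 hi]
      simp only [Set.indicator, this]
    · rw [hF]
      intro i hi
      simp [F] at hi
      exact hi.2
  · rintro ⟨y, ⟨e, hc, hk, hlt⟩, hy⟩
    rw [mat_ineq _ _ _ _ hc.1] at hlt
    have h1 := rat_of_rk _ _ _ hc hk
    have h2 : (q e.unpair.1 : ℝ) = e.unpair.2.unpair.1 / e.unpair.2.unpair.2 := by
      rw [h1]; push_cast; rfl
    rw [← h2] at hlt
    have hmono' : Monotone (fun n => (q n : ℝ)) := fun a b h => Rat.cast_le.2 (hmono h)
    have h3 := hmono'.ge_of_tendsto hlim e.unpair.1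
    by_contra hn
    have h4 := upper A n hn
    rw [← hbits] at h4
    have h5 : ∑ i ∈ Finset.range n, Set.indicator A (fun n => (2:ℝ)⁻¹ ^ (n + 1)) i ≤
        ∑ i ∈ Finset.range n, Set.indicator (Dfin y)ᶜ (fun n => (2:ℝ)⁻¹ ^ (n + 1)) i := by
      refine Finset.sum_le_sum fun i _ => ?_
      refine Set.indicator_le_indicator_of_subset ?_ (fun _ => by positivity) i
      exact Set.subset_compl_comm.1 hy
    linarith
end

section
/- No weakly 3-random set has cototal enumeration degree. -/
open MeasureTheory

/-! ### Computability part -/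

section Calculus

variable {α β : Type} [Primcodable α] [Primcodable β]

/-- Families of clopen classes, uniformly computable. -/
def DecF (P : α → (ℕ → Bool) → Prop) : Prop :=
  ∃ (g : α → ℕ) (r : α × List Bool → Bool), Computable g ∧ Computable r ∧
    ∀ a A, P a A ↔ r (a, res A (g a)) = true

/-- Uniformly Sigma-1 families. -/
def Sg1 (P : α → (ℕ → Bool) → Prop) : Prop :=
  ∃ Q : α × ℕ → (ℕ → Bool) → Prop, DecF Q ∧ ∀ a A, P a A ↔ ∃ k, Q (a, k) A

/-- Uniformly Sigma-2 families. -/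
def Sg2 (P : α → (ℕ → Bool) → Prop) : Prop :=
  ∃ Q : α × ℕ → (ℕ → Bool) → Prop, Sg1 Q ∧ ∀ a A, P a A ↔ ∃ k, ¬ Q (a, k) A

theorem res_take (A : ℕ → Bool) {i j : ℕ} (h : i ≤ j) : (res A j).take i = res A i := by
  apply List.ext_getElem
  · simp [res, h]
  · intro n h1 h2
    simp [res]

theorem res_length (A : ℕ → Bool) (j : ℕ) : (res A j).length = j := by simp [res]

theorem res_getD (A : ℕ → Bool) {i j : ℕ} (h : i < j) : (res A j).getD i false = A i := by
  simp [res, List.getD, h]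

theorem DecF.congr {P Q : α → (ℕ → Bool) → Prop} (h : DecF P) (e : ∀ a A, Q a A ↔ P a A) :
    DecF Q := by
  obtain rfl : Q = P := by funext a A; exact propext (e a A)
  exact h

theorem Sg1.congr {P Q : α → (ℕ → Bool) → Prop} (h : Sg1 P) (e : ∀ a A, Q a A ↔ P a A) :
    Sg1 Q := by
  obtain rfl : Q = P := by funext a A; exact propext (e a A)
  exact h

theorem Sg2.congr {P Q : α → (ℕ → Bool) → Prop} (h : Sg2 P) (e : ∀ a A, Q a A ↔ P a A) :
    Sg2 Q := by
  obtain rfl : Q = P := by funext a A; exact propext (e a A)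
  exact h

theorem DecF.not {P : α → (ℕ → Bool) → Prop} (h : DecF P) : DecF (fun a A => ¬ P a A) := by
  obtain ⟨g, r, hg, hr, e⟩ := h
  refine ⟨g, fun p => !(r p), hg, Primrec.not.to_comp.comp hr, ?_⟩
  intro a A
  simp [e]

theorem DecF.comp {P : α → (ℕ → Bool) → Prop} (h : DecF P) {f : β → α} (hf : Computable f) :
    DecF (fun b A => P (f b) A) := by
  obtain ⟨g, r, hg, hr, e⟩ := h
  exact ⟨fun b => g (f b), fun p => r (f p.1, p.2), hg.comp hf,
    hr.comp ((hf.comp Computable.fst).pair Computable.snd), fun a A => e _ _⟩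

theorem DecF.and {P Q : α → (ℕ → Bool) → Prop} (h : DecF P) (h' : DecF Q) :
    DecF (fun a A => P a A ∧ Q a A) := by
  obtain ⟨g, r, hg, hr, e⟩ := h
  obtain ⟨g', r', hg', hr', e'⟩ := h'
  refine ⟨fun a => g a + g' a,
    fun p => (r (p.1, p.2.take (g p.1))) && (r' (p.1, p.2.take (g' p.1))), ?_, ?_, ?_⟩
  · exact Primrec.nat_add.to_comp.comp hg hg'
  · exact Primrec.and.to_comp.comp
      (hr.comp (Computable.fst.pair
        (Primrec.list_take.to_comp.comp (hg.comp Computable.fst) Computable.snd)))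
      (hr'.comp (Computable.fst.pair
        (Primrec.list_take.to_comp.comp (hg'.comp Computable.fst) Computable.snd)))
  · intro a A
    simp [e, e', res_take]

theorem DecF.or {P Q : α → (ℕ → Bool) → Prop} (h : DecF P) (h' : DecF Q) :
    DecF (fun a A => P a A ∨ Q a A) :=
  (h.not.and h'.not).not.congr fun a A => by tauto

theorem DecF.ofComputable {f : α → Bool} (hf : Computable f) :
    DecF (fun a _ => f a = true) :=
  ⟨fun _ => 0, fun p => f p.1, Computable.const 0, hf.comp Computable.fst, fun _ _ => Iff.rfl⟩

theorem DecF.mem : DecF (fun (n : ℕ) A => n ∈ toSet A) := by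
  refine ⟨fun n => n + 1, fun p => p.2.getD p.1 false, Computable.succ,
    ((Primrec.list_getD false).comp Primrec.snd Primrec.fst).to_comp, ?_⟩
  intro n A
  simp only [res_getD A (Nat.lt_succ_self n)]
  rfl

theorem comp_unpair_left : Computable (fun p : α × ℕ => (p.1, p.2.unpair.1)) :=
  Computable.fst.pair (Computable.fst.comp (Computable.unpair.comp Computable.snd))

theorem comp_unpair_right : Computable (fun p : α × ℕ => (p.1, p.2.unpair.2)) :=
  Computable.fst.pair (Computable.snd.comp (Computable.unpair.comp Computable.snd))

theorem comp_unpair_assoc :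
    Computable (fun p : α × ℕ => ((p.1, p.2.unpair.1), p.2.unpair.2)) :=
  comp_unpair_left.pair (Computable.snd.comp (Computable.unpair.comp Computable.snd))

theorem DecF.sg1 {P : α → (ℕ → Bool) → Prop} (h : DecF P) : Sg1 P :=
  ⟨fun p A => P p.1 A, h.comp Computable.fst, fun a A => by simp⟩

theorem Sg1.comp {P : α → (ℕ → Bool) → Prop} (h : Sg1 P) {f : β → α} (hf : Computable f) :
    Sg1 (fun b A => P (f b) A) := by
  obtain ⟨Q, hQ, e⟩ := h
  exact ⟨fun p A => Q (f p.1, p.2) A,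
    hQ.comp ((hf.comp Computable.fst).pair Computable.snd), fun a A => e _ _⟩

theorem Sg1.ex {P : α × ℕ → (ℕ → Bool) → Prop} (h : Sg1 P) :
    Sg1 (fun a A => ∃ x, P (a, x) A) := by
  obtain ⟨Q, hQ, e⟩ := h
  refine ⟨fun p A => Q ((p.1, p.2.unpair.1), p.2.unpair.2) A,
    hQ.comp comp_unpair_assoc, fun a A => ?_⟩
  simp only [e]
  constructor
  · rintro ⟨x, k, hk⟩
    exact ⟨Nat.pair x k, by simpa using hk⟩
  · rintro ⟨k, hk⟩
    exact ⟨_, _, hk⟩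

theorem Sg1.or {P Q : α → (ℕ → Bool) → Prop} (h : Sg1 P) (h' : Sg1 Q) :
    Sg1 (fun a A => P a A ∨ Q a A) := by
  obtain ⟨P', hP, e⟩ := h
  obtain ⟨Q', hQ, e'⟩ := h'
  refine ⟨_, hP.or hQ, fun a A => ?_⟩
  simp only [e, e', exists_or]

theorem Sg1.and {P Q : α → (ℕ → Bool) → Prop} (h : Sg1 P) (h' : Sg1 Q) :
    Sg1 (fun a A => P a A ∧ Q a A) := by
  obtain ⟨P', hP, e⟩ := h
  obtain ⟨Q', hQ, e'⟩ := h'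
  refine ⟨_, (hP.comp comp_unpair_left).and (hQ.comp comp_unpair_right), fun a A => ?_⟩
  simp only [e, e']
  constructor
  · rintro ⟨⟨k, hk⟩, l, hl⟩
    exact ⟨Nat.pair k l, by simpa using ⟨hk, hl⟩⟩
  · rintro ⟨k, hk, hl⟩
    exact ⟨⟨_, hk⟩, _, hl⟩

theorem Sg1.not_sg2 {P : α → (ℕ → Bool) → Prop} (h : Sg1 P) : Sg2 (fun a A => ¬ P a A) :=
  ⟨fun p A => P p.1 A, h.comp Computable.fst, fun a A => by simp⟩

theorem Sg1.sg2 {P : α → (ℕ → Bool) → Prop} (h : Sg1 P) : Sg2 P := by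
  obtain ⟨Q, hQ, e⟩ := h
  exact ⟨fun p A => ¬ Q p A, hQ.not.sg1, fun a A => by simp [e]⟩

theorem Sg2.comp {P : α → (ℕ → Bool) → Prop} (h : Sg2 P) {f : β → α} (hf : Computable f) :
    Sg2 (fun b A => P (f b) A) := by
  obtain ⟨Q, hQ, e⟩ := h
  exact ⟨fun p A => Q (f p.1, p.2) A,
    hQ.comp ((hf.comp Computable.fst).pair Computable.snd), fun a A => e _ _⟩

theorem Sg2.ex {P : α × ℕ → (ℕ → Bool) → Prop} (h : Sg2 P) :
    Sg2 (fun a A => ∃ x, P (a, x) A) := by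
  obtain ⟨Q, hQ, e⟩ := h
  refine ⟨fun p A => Q ((p.1, p.2.unpair.1), p.2.unpair.2) A,
    hQ.comp comp_unpair_assoc, fun a A => ?_⟩
  simp only [e]
  constructor
  · rintro ⟨x, k, hk⟩
    exact ⟨Nat.pair x k, by simpa using hk⟩
  · rintro ⟨k, hk⟩
    exact ⟨_, _, hk⟩

theorem Sg2.or {P Q : α → (ℕ → Bool) → Prop} (h : Sg2 P) (h' : Sg2 Q) :
    Sg2 (fun a A => P a A ∨ Q a A) := by
  obtain ⟨P', hP, e⟩ := h
  obtain ⟨Q', hQ, e'⟩ := h'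
  refine ⟨_, hP.and hQ, fun a A => ?_⟩
  simp only [e, e', not_and_or, exists_or]

theorem Sg2.and {P Q : α → (ℕ → Bool) → Prop} (h : Sg2 P) (h' : Sg2 Q) :
    Sg2 (fun a A => P a A ∧ Q a A) := by
  obtain ⟨P', hP, e⟩ := h
  obtain ⟨Q', hQ, e'⟩ := h'
  refine ⟨_, (hP.comp comp_unpair_left).or (hQ.comp comp_unpair_right), fun a A => ?_⟩
  simp only [e, e', not_or]
  constructor
  · rintro ⟨⟨k, hk⟩, l, hl⟩
    exact ⟨Nat.pair k l, by simpa using ⟨hk, hl⟩⟩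
  · rintro ⟨k, hk, hl⟩
    exact ⟨⟨_, hk⟩, _, hl⟩

end Calculus

theorem Sg2.isPi03 {P : ℕ → (ℕ → Bool) → Prop} (h : Sg2 P) : IsPi03 {A | ∀ m, P m A} := by
  obtain ⟨Q, ⟨Q', ⟨g, r, hg, hr, e''⟩, e'⟩, e⟩ := h
  let G : ℕ × ℕ × List Bool → (ℕ × ℕ) × ℕ := fun p => ((p.1, p.2.1), p.2.2.length.unpair.1)
  have hG : Computable G := by
    refine ((Primrec.fst.pair (Primrec.fst.comp Primrec.snd)).pair
      (Primrec.fst.comp (Primrec.unpair.comp (Primrec.list_length.comp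
        (Primrec.snd.comp Primrec.snd))))).to_comp
  refine ⟨fun m k σ => bif decide (g (G (m, k, σ)) ≤ σ.length) then
    !(r (G (m, k, σ), σ.take (g (G (m, k, σ))))) else true, ?_, ?_⟩
  · refine Computable.cond ?_ ?_ (Computable.const true)
    · exact (PrimrecRel.decide Primrec.nat_le).to_comp.comp (hg.comp hG)
        (Primrec.list_length.comp (Primrec.snd.comp Primrec.snd)).to_comp
    · exact Primrec.not.to_comp.comp (hr.comp (hG.pair
        (Primrec.list_take.to_comp.comp (hg.comp hG)
          (Primrec.snd.comp Primrec.snd).to_comp)))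
  · ext A
    simp only [Set.mem_ofPred_eq]
    refine forall_congr' fun m => ?_
    rw [e]
    refine exists_congr fun k => ?_
    rw [e']
    simp only [not_exists, e'', G, res_length]
    constructor
    · intro H j
      by_cases hj : g ((m, k), (Nat.unpair j).1) ≤ j
      · have := H (Nat.unpair j).1
        simp [hj, res_take, this]
      · simp [hj]
    · intro H i
      have := H (Nat.pair i (g ((m, k), i)))
      have h2 := Nat.right_le_pair i (g ((m, k), i))
      simpa [h2, res_take] using this

theorem CE.sg1 {W : Set ℕ} (h : CE W) : Sg1 (fun n _ => n ∈ W) := by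
  obtain ⟨f, hf, rfl⟩ := h
  obtain ⟨c, rfl⟩ := Nat.Partrec.Code.exists_code.1 (Partrec.nat_iff.1 hf)
  refine ⟨fun p _ => (Nat.Partrec.Code.evaln p.2 c p.1).isSome = true, ?_, ?_⟩
  · apply DecF.ofComputable
    exact (Primrec.option_isSome.comp (Nat.Partrec.Code.primrec_evaln.comp
      ((Primrec.snd.pair (Primrec.const c)).pair Primrec.fst))).to_comp
  · intro n A
    simp only [PFun.mem_dom, Nat.Partrec.Code.evaln_complete, Option.isSome_iff_exists]
    exact exists_comm

/-- One step of the decoding of a finite set. -/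
def dstep (s : ℕ × List ℕ) (m : ℕ) : ℕ × List ℕ := (m + s.1 + 1, (m + s.1) :: s.2)

/-- The finite set with index `y`, as a bound and a list. -/
def dlist (y : ℕ) : ℕ × List ℕ := (Denumerable.ofNat (List ℕ) y).foldl dstep (0, [])

theorem dlist_primrec : Primrec dlist := by
  refine Primrec.list_foldl (h := fun (_ : ℕ) (p : (ℕ × List ℕ) × ℕ) => dstep p.1 p.2) (Primrec.ofNat (List ℕ)) (Primrec.const ((0, []) : ℕ × List ℕ)) ?_
  have h : Primrec (fun p : ℕ × (ℕ × List ℕ) × ℕ => p.2.2 + p.2.1.1) :=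
    Primrec.nat_add.comp (Primrec.snd.comp Primrec.snd)
      (Primrec.fst.comp (Primrec.fst.comp Primrec.snd))
  exact ((Primrec.succ.comp h).pair (Primrec.list_cons.comp h
    (Primrec.snd.comp (Primrec.fst.comp Primrec.snd)))).to₂

theorem foldl_dstep (l : List ℕ) : ∀ s : ℕ × List ℕ,
    (∀ z, z ∈ (l.foldl dstep s).2 ↔ z ∈ s.2 ∨ z ∈ Denumerable.raise' l s.1) ∧
    ((∀ z ∈ s.2, z < s.1) → ∀ z ∈ (l.foldl dstep s).2, z < (l.foldl dstep s).1) := by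
  induction l with
  | nil => intro s; simp [Denumerable.raise']
  | cons m l ih =>
    intro s
    obtain ⟨h1, h2⟩ := ih (dstep s m)
    constructor
    · intro z
      rw [List.foldl_cons, h1]
      simp only [dstep, Denumerable.raise', List.mem_cons]
      tauto
    · intro h
      rw [List.foldl_cons]
      apply h2
      intro z hz
      simp only [dstep, List.mem_cons] at hz ⊢
      rcases hz with rfl | hz
      · omega
      · have := h z hz
        omega

theorem mem_Dfin (y z : ℕ) : z ∈ Dfin y ↔ z ∈ (dlist y).2 := by
  have h : Denumerable.ofNat (Finset ℕ) y =
      Finset.map (Denumerable.eqv ℕ).symm.toEmbedding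
        (Denumerable.raise'Finset (Denumerable.ofNat (List ℕ) y) 0) := by
    apply Denumerable.ofNat_of_decode
    rfl
  rw [Dfin, h, dlist, ((foldl_dstep _ (0, [])).1 z)]
  simp [Denumerable.raise'Finset, Denumerable.eqv, ← Finset.mem_val]

theorem dlist_lt (y z : ℕ) (h : z ∈ (dlist y).2) : z < (dlist y).1 :=
  (foldl_dstep _ (0, [])).2 (by simp) z h

theorem dec_mem_Dfin : DecF (fun (p : ℕ × ℕ) _ => p.1 ∈ Dfin p.2) := by
  have h : PrimrecPred (fun p : ℕ × ℕ => ∃ a ∈ (dlist p.2).2, a = p.1) := by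
    have h1 : PrimrecRel (fun (a b : ℕ) => a = b) := Primrec.eq
    exact h1.exists_mem_list.comp
      (Primrec.snd.comp (dlist_primrec.comp Primrec.snd)) Primrec.fst
  obtain ⟨_, h⟩ := h
  refine (DecF.ofComputable h.to_comp).congr fun p A => ?_
  simp [mem_Dfin]

theorem dec_Dfin_subset : DecF (fun (y : ℕ) A => Dfin y ⊆ toSet A) := by
  have h : PrimrecPred (fun p : ℕ × List Bool => ∀ a ∈ (dlist p.1).2, p.2.getD a false = true) := by
    have h1 : PrimrecRel (fun (a : ℕ) (σ : List Bool) => σ.getD a false = true) :=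
      Primrec.eq.comp ((Primrec.list_getD false).comp Primrec.snd Primrec.fst)
        (Primrec.const true)
    exact h1.forall_mem_list.comp
      (Primrec.snd.comp (dlist_primrec.comp Primrec.fst)) Primrec.snd
  obtain ⟨_, h⟩ := h
  refine ⟨fun y => (dlist y).1, _, (Primrec.fst.comp dlist_primrec).to_comp, h.to_comp, ?_⟩
  intro y A
  simp only [decide_eq_true_eq, Set.subset_def, mem_Dfin]
  refine forall_congr' fun z => forall_congr' fun hz => ?_
  rw [res_getD A (dlist_lt y z hz)]
  rfl

theorem sg1_enumOp {W : Set ℕ} (h : CE W) : Sg1 (fun (x : ℕ) A => x ∈ enumOp W (toSet A)) := by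
  have h1 : Sg1 (fun (p : ℕ × ℕ) (_ : ℕ → Bool) => Nat.pair p.1 p.2 ∈ W) :=
    h.sg1.comp (Primrec₂.natPair.comp Primrec.fst Primrec.snd).to_comp
  exact (h1.and (dec_Dfin_subset.comp Computable.snd).sg1).ex

theorem sg2_Dfin_subset {S : ℕ → (ℕ → Bool) → Prop} (h : Sg1 S) :
    Sg2 (fun (y : ℕ) A => ∀ z ∈ Dfin y, S z A) := by
  obtain ⟨Q, hQ, e⟩ := h
  let f : (ℕ × ℕ) × ℕ → ℕ × ℕ :=
    fun p => (p.2, (Denumerable.ofNat (List ℕ) p.1.2).getD p.2 0)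
  have hf : Computable f :=
    (Primrec.snd.pair ((Primrec.list_getD 0).comp ((Primrec.ofNat (List ℕ)).comp
      (Primrec.snd.comp Primrec.fst)) Primrec.snd)).to_comp
  have hm : DecF (fun (p : (ℕ × ℕ) × ℕ) _ => p.2 ∈ Dfin p.1.1) :=
    dec_mem_Dfin.comp (Primrec.snd.pair (Primrec.fst.comp Primrec.fst)).to_comp
  refine ⟨_, (hm.and (hQ.comp hf).not).sg1.ex, ?_⟩
  intro y A
  simp only [e, f, not_exists, not_and, not_not]
  constructor
  · intro H
    choose! L hL using H
    refine ⟨Encodable.encode ((List.range (dlist y).1).map L), fun z hz => ?_⟩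
    have hlt := dlist_lt y z ((mem_Dfin y z).1 hz)
    simpa [List.getD, hlt] using hL z hz
  · rintro ⟨k, hk⟩ z hz
    exact ⟨_, hk z hz⟩

/-- The class from the proof. -/
def cotClass (W1 W2 W3 : Set ℕ) : Set (ℕ → Bool) :=
  {A | toSet A = enumOp W1 (enumOp W2 (toSet A)) ∧
    enumOp W2 (toSet A) = enumOp W3 (enumOp W2 (toSet A))ᶜ}

theorem cotClass_pi03 {W1 W2 W3 : Set ℕ} (h1 : CE W1) (h2 : CE W2) (h3 : CE W3) :
    IsPi03 (cotClass W1 W2 W3) := by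
  have hB := sg1_enumOp h2
  have hr : Computable (fun m : ℕ => m.unpair.2) := (Primrec.snd.comp Primrec.unpair).to_comp
  have hl : Computable (fun m : ℕ => m.unpair.1) := (Primrec.fst.comp Primrec.unpair).to_comp
  have hp : Computable (fun p : ℕ × ℕ => Nat.pair p.1 p.2) :=
    (Primrec₂.natPair.comp Primrec.fst Primrec.snd).to_comp
  have hA := DecF.mem
  have c1 := hA.not.sg1.sg2.or
    (((h1.sg1.comp hp).sg2.and ((sg2_Dfin_subset hB).comp Computable.snd)).ex)
  have c2 := (h1.sg1.not_sg2.or (((dec_mem_Dfin.comp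
      (Computable.snd.pair (hr.comp Computable.fst))).sg1.sg2.and
        ((hB.comp (Computable.snd (α := ℕ))).not_sg2)).ex)).or (hA.comp hl).sg1.sg2
  have hmeet : Sg1 (fun (y : ℕ) A => ∃ z, z ∈ Dfin y ∧ z ∈ enumOp W2 (toSet A)) :=
    ((dec_mem_Dfin.comp (Computable.snd.pair Computable.fst)).sg1.and
      (hB.comp (Computable.snd (α := ℕ)))).ex
  have c3 := hB.not_sg2.or
    (((h3.sg1.comp hp).sg2.and (hmeet.comp Computable.snd).not_sg2).ex)
  have c4 := (h3.sg1.not_sg2.or (hmeet.comp hr).sg2).or (hB.comp hl).sg2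
  have key := ((c1.and c2).and (c3.and c4)).isPi03
  convert key using 1
  ext A
  simp only [cotClass, Set.mem_ofPred_eq, forall_and]
  generalize enumOp W2 (toSet A) = B
  refine and_congr ?_ ?_
  · rw [Set.Subset.antisymm_iff]
    refine and_congr ?_ ?_
    · refine forall_congr' fun n => ?_
      rw [imp_iff_not_or]
      rfl
    · constructor
      · intro H m
        by_contra hc
        push Not at hc
        obtain ⟨⟨ha, hb⟩, hd⟩ := hc
        exact hd (H ⟨m.unpair.2, by simpa using ha, hb⟩)
      · rintro H n ⟨y, hy, hD⟩
        have := H (Nat.pair n y)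
        simp only [Nat.unpair_pair] at this
        rcases this with (h | ⟨z, hz, hz'⟩) | h
        · exact (h hy).elim
        · exact (hz' (hD hz)).elim
        · exact h
  · rw [Set.Subset.antisymm_iff]
    refine and_congr ?_ ?_
    · refine forall_congr' fun n => ?_
      rw [imp_iff_not_or]
      simp only [enumOp, Set.subset_def, Set.mem_ofPred_eq, Set.mem_compl_iff, not_exists, not_and]
    · constructor
      · intro H m
        by_contra hc
        push Not at hc
        obtain ⟨⟨ha, hb⟩, hd⟩ := hc
        exact hd (H ⟨m.unpair.2, by simpa using ha, hb⟩)
      · rintro H n ⟨y, hy, hD⟩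
        have := H (Nat.pair n y)
        simp only [Nat.unpair_pair] at this
        rcases this with (h | ⟨z, hz, hz'⟩) | h
        · exact (h hy).elim
        · exact (hD hz hz').elim
        · exact h

theorem enumOp_mono (W : Set ℕ) {X Y : Set ℕ} (h : X ⊆ Y) : enumOp W X ⊆ enumOp W Y :=
  fun _ ⟨y, hy, hD⟩ => ⟨y, hy, hD.trans h⟩

theorem cotClass_antichain {W1 W2 W3 : Set ℕ} {A A' : ℕ → Bool} (h : A ∈ cotClass W1 W2 W3)
    (h' : A' ∈ cotClass W1 W2 W3) (hs : toSet A ⊆ toSet A') : toSet A = toSet A' := by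
  obtain ⟨a, b⟩ := h
  obtain ⟨a', b'⟩ := h'
  have h1 := enumOp_mono W2 hs
  have h2 := enumOp_mono W3 (Set.compl_subset_compl.2 h1)
  rw [← b, ← b'] at h2
  rw [a, a', Set.Subset.antisymm h1 h2]

/-! ### Measure part -/

/-- Flip the `n`-th bit. -/
def flipBit (n : ℕ) (A : ℕ → Bool) : ℕ → Bool := Function.update A n (!(A n))

theorem flipBit_same (n : ℕ) (A : ℕ → Bool) : flipBit n A n = !(A n) := by simp [flipBit]

theorem flipBit_ne {n i : ℕ} (h : i ≠ n) (A : ℕ → Bool) : flipBit n A i = A i := by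
  simp [flipBit, h]

theorem cyl_res (x : ℕ → Bool) (n : ℕ) : cyl (res x n) = PiNat.cylinder x n := by
  ext A
  simp only [cyl, PiNat.mem_cylinder_iff, Set.mem_ofPred_eq]
  constructor
  · intro h i hi
    simpa [res] using h ⟨i, by simpa [res] using hi⟩
  · rintro h ⟨i, hi⟩
    simpa [res] using h i (by simpa [res] using hi)

theorem coin_cylinder {μ : Measure (ℕ → Bool)} (hμ : IsCoinMeasure μ) (x : ℕ → Bool) (n : ℕ) :
    μ (PiNat.cylinder x n) = 2⁻¹ ^ n := by
  rw [← cyl_res, hμ, res_length]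

theorem coin_univ {μ : Measure (ℕ → Bool)} (hμ : IsCoinMeasure μ) : μ Set.univ = 1 := by
  have := coin_cylinder hμ (fun _ => false) 0
  simpa using this

theorem flipBit_preimage (n k : ℕ) (x : ℕ → Bool) :
    flipBit n ⁻¹' PiNat.cylinder x k = PiNat.cylinder (flipBit n x) k := by
  ext A
  simp only [Set.mem_preimage, PiNat.mem_cylinder_iff]
  refine forall_congr' fun i => forall_congr' fun _ => ?_
  by_cases h : i = n
  · subst h
    rw [flipBit_same, flipBit_same]
    cases A i <;> cases x i <;> simp
  · rw [flipBit_ne h, flipBit_ne h]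

theorem flipBit_measurable (n : ℕ) : Measurable (flipBit n) := by
  rw [measurable_pi_iff]
  intro i
  by_cases h : i = n
  · subst h
    simp only [flipBit_same]
    exact (measurable_of_countable (fun b : Bool => !b)).comp (measurable_pi_apply i)
  · simp only [flipBit_ne h]
    exact measurable_pi_apply i

theorem flipBit_map {μ : Measure (ℕ → Bool)} (hμ : IsCoinMeasure μ) (n : ℕ) :
    μ.map (flipBit n) = μ := by
  have : IsFiniteMeasure μ := ⟨by rw [coin_univ hμ]; exact ENNReal.one_lt_top⟩
  symm
  refine ext_of_generate_finite
    {s : Set (ℕ → Bool) | ∃ (x : ℕ → Bool) (n : ℕ), s = PiNat.cylinder x n} ?_ ?_ ?_ ?_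
  · rw [← (PiNat.isTopologicalBasis_cylinders (fun _ : ℕ => Bool)).borel_eq_generateFrom]
    exact BorelSpace.measurable_eq
  · rintro _ ⟨x, k, rfl⟩ _ ⟨y, l, rfl⟩ ⟨z, hx, hy⟩
    refine ⟨z, max k l, ?_⟩
    ext A
    simp only [Set.mem_inter_iff, PiNat.mem_cylinder_iff] at *
    constructor
    · rintro ⟨h1, h2⟩ i hi
      rcases lt_max_iff.1 hi with h | h
      · rw [h1 i h, hx i h]
      · rw [h2 i h, hy i h]
    · intro h
      exact ⟨fun i hi => (h i (lt_max_of_lt_left hi)).trans (hx i hi),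
        fun i hi => (h i (lt_max_of_lt_right hi)).trans (hy i hi)⟩
  · rintro _ ⟨x, k, rfl⟩
    rw [Measure.map_apply (flipBit_measurable n)
      (PiNat.isOpen_cylinder (fun _ : ℕ => Bool) x k).measurableSet, flipBit_preimage,
      coin_cylinder hμ, coin_cylinder hμ]
  · rw [Measure.map_apply (flipBit_measurable n) MeasurableSet.univ, Set.preimage_univ]

theorem measurable_res (j : ℕ) (σ : List Bool) : MeasurableSet {A : ℕ → Bool | res A j = σ} := by
  by_cases h : ∃ x, res x j = σ
  · obtain ⟨x, rfl⟩ := h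
    convert (PiNat.isOpen_cylinder (fun _ : ℕ => Bool) x j).measurableSet using 1
    ext A
    simp only [Set.mem_ofPred_eq, PiNat.mem_cylinder_iff]
    constructor
    · intro h i hi
      rw [← res_getD A hi, h, res_getD x hi]
    · intro h
      simp only [res]
      congr 1
      funext i
      exact h i i.2
  · convert MeasurableSet.empty
    ext A
    simp only [Set.mem_ofPred_eq, Set.mem_empty_iff_false, iff_false]
    exact fun hA => h ⟨A, hA⟩

theorem IsPi03.measurable {C : Set (ℕ → Bool)} (h : IsPi03 C) : MeasurableSet C := by
  obtain ⟨R, -, rfl⟩ := h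
  have key : ∀ m k j, MeasurableSet {A : ℕ → Bool | R m k (res A j) = true} := by
    intro m k j
    have e : {A : ℕ → Bool | R m k (res A j) = true} =
        ⋃ σ ∈ {σ : List Bool | R m k σ = true}, {A : ℕ → Bool | res A j = σ} := by
      ext A
      simp
    rw [e]
    exact MeasurableSet.biUnion (Set.to_countable _) fun σ _ => measurable_res j σ
  have e : {A : ℕ → Bool | ∀ m, ∃ k, ∀ j, R m k (res A j) = true} =
      ⋂ m, ⋃ k, ⋂ j, {A : ℕ → Bool | R m k (res A j) = true} := by
    ext A
    simp
  rw [e]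
  exact MeasurableSet.iInter fun m => MeasurableSet.iUnion fun k =>
    MeasurableSet.iInter fun j => key m k j

theorem null_of_flip {μ : Measure (ℕ → Bool)} (hμ : IsCoinMeasure μ) {C : Set (ℕ → Bool)}
    (hC : MeasurableSet C) (hf : ∀ n, Disjoint C (flipBit n ⁻¹' C)) : μ C = 0 := by
  have : IsFiniteMeasure μ := ⟨by rw [coin_univ hμ]; exact ENNReal.one_lt_top⟩
  by_contra hne
  have hr : 0 < μ.real C := by
    rw [Measure.real]
    exact ENNReal.toReal_pos hne (measure_ne_top _ _)
  have hpre : ∀ n (S : Set (ℕ → Bool)), MeasurableSet S → μ.real (flipBit n ⁻¹' S) = μ.real S := by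
    intro n S hS
    conv_rhs => rw [← flipBit_map hμ n]
    rw [measureReal_def, measureReal_def, Measure.map_apply (flipBit_measurable n) hS]
  set ε := μ.real C / 4 with hε
  obtain ⟨U, hCU, hU, hlt⟩ := C.exists_isOpen_lt_add (μ := μ) (measure_ne_top _ _)
    (ε := ENNReal.ofReal ε) (by simp; positivity)
  have hlt' : μ.real U < μ.real C + ε := by
    have h1 := (ENNReal.toReal_lt_toReal (measure_ne_top μ U) (by finiteness)).2 hlt
    rwa [ENNReal.toReal_add (measure_ne_top μ C) (by finiteness),
      ENNReal.toReal_ofReal (by positivity)] at h1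
  let V : ℕ → Set (ℕ → Bool) := fun k => {A | PiNat.cylinder A k ⊆ U}
  have hVo : ∀ k, IsOpen (V k) := by
    intro k
    rw [isOpen_iff_mem_nhds]
    intro A hA
    refine Filter.mem_of_superset ((PiNat.isOpen_cylinder (fun _ : ℕ => Bool) A k).mem_nhds
      (PiNat.self_mem_cylinder A k)) ?_
    intro A' hA'
    have : PiNat.cylinder A' k = PiNat.cylinder A k := PiNat.mem_cylinder_iff_eq.1 hA'
    change PiNat.cylinder A' k ⊆ U
    rw [this]
    exact hA
  have hVm : Monotone V := fun k l hkl A hA => (PiNat.cylinder_anti A hkl).trans hA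
  have hVU : ⋃ k, V k = U := by
    ext A
    rw [Set.mem_iUnion]
    constructor
    · rintro ⟨k, hk⟩
      exact hk (PiNat.self_mem_cylinder A k)
    · intro hA
      obtain ⟨_, ⟨x, n, rfl⟩, h1, h2⟩ := (PiNat.isTopologicalBasis_cylinders
        (fun _ : ℕ => Bool)).exists_subset_of_mem_open hA hU
      refine ⟨n, ?_⟩
      change PiNat.cylinder A n ⊆ U
      rwa [PiNat.mem_cylinder_iff_eq.1 h1]
  have hVflip : ∀ k, flipBit k ⁻¹' V k = V k := by
    intro k
    ext A
    have : PiNat.cylinder (flipBit k A) k = PiNat.cylinder A k := by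
      apply PiNat.mem_cylinder_iff_eq.1
      rw [PiNat.mem_cylinder_iff]
      intro i hi
      exact flipBit_ne hi.ne A
    change PiNat.cylinder (flipBit k A) k ⊆ U ↔ PiNat.cylinder A k ⊆ U
    rw [this]
  -- choose `k`
  have htend : Filter.Tendsto (fun k => μ.real (C ∩ V k)) Filter.atTop (nhds (μ.real C)) := by
    have h1 : Filter.Tendsto (fun k => μ (C ∩ V k)) Filter.atTop (nhds (μ (⋃ k, C ∩ V k))) :=
      tendsto_measure_iUnion_atTop (fun k l hkl => Set.inter_subset_inter_right C (hVm hkl))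
    rw [← Set.inter_iUnion, hVU, Set.inter_eq_left.2 hCU] at h1
    exact (ENNReal.tendsto_toReal (measure_ne_top μ C)).comp h1
  obtain ⟨k, hk⟩ := (htend.eventually (lt_mem_nhds (show μ.real C - ε < μ.real C by
    rw [hε]; linarith))).exists
  have h1 : μ.real (flipBit k ⁻¹' (C ∩ V k)) = μ.real (C ∩ V k) :=
    hpre k _ (hC.inter (hVo k).measurableSet)
  have hd : Disjoint (C ∩ V k) (flipBit k ⁻¹' (C ∩ V k)) :=
    (hf k).mono Set.inter_subset_left (Set.preimage_mono Set.inter_subset_left)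
  have h2 := measureReal_union (μ := μ) hd
    (flipBit_measurable k (hC.inter (hVo k).measurableSet))
  have h3 : (C ∩ V k) ∪ flipBit k ⁻¹' (C ∩ V k) ⊆ U := by
    have hVk : V k ⊆ U := hVU ▸ Set.subset_iUnion V k
    refine Set.union_subset (Set.inter_subset_right.trans hVk) ?_
    rw [Set.preimage_inter, hVflip]
    exact Set.inter_subset_right.trans hVk
  have h4 : μ.real ((C ∩ V k) ∪ flipBit k ⁻¹' (C ∩ V k)) ≤ μ.real U := measureReal_mono h3
  rw [h2, h1] at h4
  rw [hε] at *
  linarith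

theorem cotClass_flip (W1 W2 W3 : Set ℕ) (n : ℕ) :
    Disjoint (cotClass W1 W2 W3) (flipBit n ⁻¹' cotClass W1 W2 W3) := by
  rw [Set.disjoint_left]
  intro A hA hA'
  have hA2 : flipBit n A ∈ cotClass W1 W2 W3 := hA'
  have heq : toSet A = toSet (flipBit n A) := by
    cases hn : A n
    · refine cotClass_antichain hA hA2 fun i (hi : A i = true) => ?_
      change flipBit n A i = true
      rw [flipBit_ne (by rintro rfl; simp [hn] at hi), hi]
    · refine (cotClass_antichain hA2 hA fun i (hi : flipBit n A i = true) => ?_).symm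
      by_cases h : i = n
      · subst h; exact hn
      · rw [flipBit_ne h] at hi
        exact hi
  have h1 : A n = true ↔ flipBit n A n = true := Set.ext_iff.1 heq n
  rw [flipBit_same] at h1
  cases hn : A n <;> simp [hn] at h1

/-- No weakly 3-random set has cototal enumeration degree. -/
theorem stmt_14 (μ : Measure (ℕ → Bool)) (hμ : IsCoinMeasure μ)
    (A : ℕ → Bool) (h : Weak3Random μ A) :
    ¬ ∃ B : Set ℕ, EnumEquiv (toSet A) B ∧ Cototal B := by
  rintro ⟨B, ⟨⟨W1, h1, e1⟩, ⟨W2, h2, e2⟩⟩, ⟨W3, h3, e3⟩⟩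
  have hpi := cotClass_pi03 h1 h2 h3
  refine h _ hpi (null_of_flip hμ hpi.measurable (cotClass_flip W1 W2 W3)) ⟨?_, ?_⟩
  · rw [← e2]
    exact e1
  · rw [← e2]
    exact e3
end

section
/- There exists a 2-random set of cototal enumeration degree; specifically, Ω relativized to the halting problem, Ω^{∅'}, is 2-random and is enumeration-equivalent to a cototal set. -/
open MeasureTheory

namespace TR
open Nat.Partrec (Code)

/-- All binary strings of a given length. -/
def allStr : ℕ → List (List Bool)
  | 0 => [[]]
  | n + 1 => (allStr n).flatMap fun σ => [false :: σ, true :: σ]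

theorem allStr_primrec : Primrec allStr := by
  have : Primrec (Nat.rec [[]] (fun _ l => l.flatMap fun σ => [false :: σ, true :: σ]) :
      ℕ → List (List Bool)) := by
    apply Primrec.nat_rec₁
    apply Primrec.list_flatMap Primrec.snd
    exact Primrec.list_cons.comp (Primrec.list_cons.comp (Primrec.const _) Primrec.snd)
      (Primrec.list_cons.comp (Primrec.list_cons.comp (Primrec.const _) Primrec.snd)
        (Primrec.const _))
  refine this.of_eq fun n => ?_
  induction n with
  | zero => rfl
  | succ n ih => simp only [allStr, ← ih]

theorem mem_allStr {n : ℕ} {σ : List Bool} : σ ∈ allStr n ↔ σ.length = n := by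
  induction n generalizing σ with
  | zero => simp [allStr]
  | succ n ih =>
    simp only [allStr, List.mem_flatMap, List.mem_cons, List.not_mem_nil, or_false]
    constructor
    · rintro ⟨τ, hτ, rfl | rfl⟩ <;> simp [ih.1 hτ]
    · intro h
      cases σ with
      | nil => simp at h
      | cons b τ =>
        refine ⟨τ, ih.2 (by simpa using h), ?_⟩
        cases b <;> simp

theorem nodup_allStr (n : ℕ) : (allStr n).Nodup := by
  induction n with
  | zero => simp [allStr]
  | succ n ih =>
    rw [allStr, List.nodup_flatMap]
    refine ⟨fun σ _ => by simp, ih.imp ?_⟩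
    intro a b hab
    simp [Function.onFun, List.disjoint_left, hab]

/-- Not yet seen (by stage `t`) to be rejected by the `e`-th test. -/
def Qb (e m k : ℕ) (σ : List Bool) (t : ℕ) : Prop :=
  Code.evaln t (Denumerable.ofNat Code e) (Encodable.encode (m, k, σ)) ≠
    some (Encodable.encode false)

/-- `w = (e, k, s)`: the string `η` is in the clopen set given by `w`. -/
def inG (w : ℕ × ℕ × ℕ) (η : List Bool) : Prop :=
  ∃ k' < w.2.1 + 1, ∀ j < w.2.2 + 1, Qb w.1 (w.1 + 3) k' (η.take j) w.2.2

theorem all_list {α γ : Type*} [Primcodable α] [Primcodable γ] {f : γ → List α}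
    {R : α → γ → Prop} (hf : Primrec f) (hR : PrimrecPred fun p : α × γ => R p.1 p.2) :
    PrimrecPred fun c => ∀ a ∈ f c, R a c :=
  (PrimrecRel.forall_mem_list (R := R) hR).comp hf Primrec.id

theorem ex_list {α γ : Type*} [Primcodable α] [Primcodable γ] {f : γ → List α}
    {R : α → γ → Prop} (hf : Primrec f) (hR : PrimrecPred fun p : α × γ => R p.1 p.2) :
    PrimrecPred fun c => ∃ a ∈ f c, R a c :=
  (PrimrecRel.exists_mem_list (R := R) hR).comp hf Primrec.id

theorem all_lt {γ : Type*} [Primcodable γ] {f : γ → ℕ}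
    {R : ℕ → γ → Prop} (hf : Primrec f) (hR : PrimrecPred fun p : ℕ × γ => R p.1 p.2) :
    PrimrecPred fun c => ∀ a < f c, R a c :=
  (all_list (Primrec.list_range.comp hf) hR).of_eq fun c => by simp

theorem ex_lt {γ : Type*} [Primcodable γ] {f : γ → ℕ}
    {R : ℕ → γ → Prop} (hf : Primrec f) (hR : PrimrecPred fun p : ℕ × γ => R p.1 p.2) :
    PrimrecPred fun c => ∃ a < f c, R a c :=
  (ex_list (Primrec.list_range.comp hf) hR).of_eq fun c => by simp

theorem Qb_primrec : PrimrecPred fun p : ℕ × ℕ × ℕ × List Bool × ℕ =>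
    Qb p.1 p.2.1 p.2.2.1 p.2.2.2.1 p.2.2.2.2 := by
  unfold Qb
  refine PrimrecPred.not ?_
  refine PrimrecRel.comp Primrec.eq ?_ (Primrec.const _)
  refine Code.primrec_evaln.comp (Primrec.pair (Primrec.pair ?_ ?_) ?_)
  · exact Primrec.snd.comp (Primrec.snd.comp (Primrec.snd.comp Primrec.snd))
  · exact (Primrec.ofNat Code).comp Primrec.fst
  · refine Primrec.encode.comp (Primrec.pair ?_ (Primrec.pair ?_ ?_))
    · exact Primrec.fst.comp Primrec.snd
    · exact Primrec.fst.comp (Primrec.snd.comp Primrec.snd)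
    · exact Primrec.fst.comp (Primrec.snd.comp (Primrec.snd.comp Primrec.snd))

theorem inG_primrec : PrimrecPred fun p : (ℕ × ℕ × ℕ) × List Bool => inG p.1 p.2 := by
  unfold inG
  refine ex_lt (f := fun p : (ℕ × ℕ × ℕ) × List Bool => p.1.2.1 + 1)
    (R := fun k' (p : (ℕ × ℕ × ℕ) × List Bool) =>
      ∀ j < p.1.2.2 + 1, Qb p.1.1 (p.1.1 + 3) k' (p.2.take j) p.1.2.2) ?_ ?_
  · exact Primrec.succ.comp (Primrec.fst.comp (Primrec.snd.comp Primrec.fst))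
  · refine all_lt (f := fun q : ℕ × (ℕ × ℕ × ℕ) × List Bool => q.2.1.2.2 + 1)
      (R := fun j (q : ℕ × (ℕ × ℕ × ℕ) × List Bool) =>
        Qb q.2.1.1 (q.2.1.1 + 3) q.1 (q.2.2.take j) q.2.1.2.2) ?_ ?_
    · exact Primrec.succ.comp
        (Primrec.snd.comp (Primrec.snd.comp (Primrec.fst.comp Primrec.snd)))
    · have hw : Primrec fun r : ℕ × ℕ × (ℕ × ℕ × ℕ) × List Bool => r.2.2.1 :=
        Primrec.fst.comp (Primrec.snd.comp Primrec.snd)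
      refine Qb_primrec.comp (f := fun r : ℕ × ℕ × (ℕ × ℕ × ℕ) × List Bool =>
        (r.2.2.1.1, r.2.2.1.1 + 3, r.2.1, r.2.2.2.take r.1, r.2.2.1.2.2)) ?_
      refine Primrec.pair (Primrec.fst.comp hw) (Primrec.pair ?_ (Primrec.pair
        (Primrec.fst.comp Primrec.snd) (Primrec.pair ?_
        (Primrec.snd.comp (Primrec.snd.comp hw)))))
      · exact Primrec.nat_add.comp (Primrec.fst.comp hw) (Primrec.const 3)
      · exact Primrec.list_take.comp Primrec.fst
          (Primrec.snd.comp (Primrec.snd.comp Primrec.snd))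

open Classical in
/-- Number of strings of length `s` in the clopen set given by `w`. -/
noncomputable def cnt (w : ℕ × ℕ × ℕ) : ℕ := ((allStr w.2.2).filter (fun η => inG w η)).length

theorem cnt_primrec : Primrec cnt := by
  classical
  have h1 : Primrec fun w : ℕ × ℕ × ℕ =>
      ((allStr w.2.2).flatMap fun η => if inG w η then [η] else []) := by
    refine Primrec.list_flatMap (allStr_primrec.comp (Primrec.snd.comp Primrec.snd)) ?_
    exact Primrec.ite inG_primrec (Primrec.list_cons.comp Primrec.snd (Primrec.const []))
      (Primrec.const [])
  refine (Primrec.list_length.comp h1).of_eq fun w => ?_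
  unfold cnt
  congr 1
  induction allStr w.2.2 with
  | nil => rfl
  | cons a l ih => by_cases h : inG w a <;> simp [h, ih]

theorem pow2_primrec : Primrec (fun n : ℕ => 2 ^ n) := by
  have : Primrec (Nat.rec 1 (fun _ l => l * 2) : ℕ → ℕ) := by
    apply Primrec.nat_rec₁
    exact Primrec.nat_mul.comp Primrec.snd (Primrec.const 2)
  refine this.of_eq fun n => ?_
  induction n with
  | zero => rfl
  | succ n ih => simp only [pow_succ, ← ih]

/-- stage `t` of the `Π⁰₁` condition saying that the clopen set of `w = (e,k,s)` is a good
approximation of the closed set it approximates and is small. -/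
def good (w : ℕ × ℕ × ℕ) (t : ℕ) : Prop :=
  cnt w * 2 ^ (w.1 + 3) ≤ 2 ^ (w.2.2 + 1) ∧
  (t < w.2.2 ∨ cnt w * 2 ^ t * 2 ^ (w.1 + w.2.1 + 4) ≤
    cnt (w.1, w.2.1, t) * 2 ^ w.2.2 * 2 ^ (w.1 + w.2.1 + 4) + 2 ^ w.2.2 * 2 ^ t)

theorem good_primrec : PrimrecPred fun p : (ℕ × ℕ × ℕ) × ℕ => good p.1 p.2 := by
  have hw : Primrec fun p : (ℕ × ℕ × ℕ) × ℕ => p.1 := Primrec.fst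
  have he : Primrec fun p : (ℕ × ℕ × ℕ) × ℕ => p.1.1 := Primrec.fst.comp hw
  have hk : Primrec fun p : (ℕ × ℕ × ℕ) × ℕ => p.1.2.1 := Primrec.fst.comp (Primrec.snd.comp hw)
  have hs : Primrec fun p : (ℕ × ℕ × ℕ) × ℕ => p.1.2.2 := Primrec.snd.comp (Primrec.snd.comp hw)
  have ht : Primrec fun p : (ℕ × ℕ × ℕ) × ℕ => p.2 := Primrec.snd
  have hc : Primrec fun p : (ℕ × ℕ × ℕ) × ℕ => cnt p.1 := cnt_primrec.comp hw
  have hP : Primrec fun p : (ℕ × ℕ × ℕ) × ℕ => 2 ^ (p.1.1 + p.1.2.1 + 4) :=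
    pow2_primrec.comp (Primrec.nat_add.comp (Primrec.nat_add.comp he hk) (Primrec.const 4))
  have h2s := pow2_primrec.comp hs
  have h2t := pow2_primrec.comp ht
  unfold good
  refine PrimrecPred.and ?_ (PrimrecPred.or ?_ ?_)
  · exact Primrec.nat_le.comp (Primrec.nat_mul.comp hc
      (pow2_primrec.comp (Primrec.nat_add.comp he (Primrec.const 3))))
      (pow2_primrec.comp (Primrec.succ.comp hs))
  · exact Primrec.nat_lt.comp ht hs
  · refine Primrec.nat_le.comp (Primrec.nat_mul.comp (Primrec.nat_mul.comp hc h2t) hP)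
      (Primrec.nat_add.comp (Primrec.nat_mul.comp (Primrec.nat_mul.comp ?_ h2s) hP)
        (Primrec.nat_mul.comp h2s h2t))
    exact cnt_primrec.comp (Primrec.pair he (Primrec.pair hk ht))

/-- A candidate certificate `(n, z, W, N)`. -/
abbrev Cert := ℕ × List ℕ × List (ℕ × ℕ × ℕ) × ℕ

/-- The decidable part of a certificate. -/
def psi (q : Cert) : Prop :=
  (∀ w ∈ q.2.2.1, w.2.2 < q.2.2.2 + 1) ∧
  ∀ η ∈ allStr q.2.2.2, (η[q.1]? = some true ∨ ∃ i ∈ q.2.1, η[i]? = some true) ∨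
    ∃ w ∈ q.2.2.1, inG w η

/-- Certificate checking up to stage `t`. -/
def phi (q : Cert) (t : ℕ) : Prop := (∀ w ∈ q.2.2.1, good w t) ∧ psi q

theorem psi_primrec : PrimrecPred psi := by
  have hW : Primrec fun q : Cert => q.2.2.1 := Primrec.fst.comp (Primrec.snd.comp Primrec.snd)
  have hN : Primrec fun q : Cert => q.2.2.2 := Primrec.snd.comp (Primrec.snd.comp Primrec.snd)
  have hz : Primrec fun q : Cert => q.2.1 := Primrec.fst.comp Primrec.snd
  have hn : Primrec fun q : Cert => q.1 := Primrec.fst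
  unfold psi
  refine PrimrecPred.and ?_ ?_
  · refine all_list (R := fun (w : ℕ × ℕ × ℕ) (q : Cert) => w.2.2 < q.2.2.2 + 1) hW ?_
    exact Primrec.nat_lt.comp (Primrec.snd.comp (Primrec.snd.comp Primrec.fst))
      (Primrec.succ.comp (hN.comp Primrec.snd))
  · refine all_list (R := fun (η : List Bool) (q : Cert) =>
      (η[q.1]? = some true ∨ ∃ i ∈ q.2.1, η[i]? = some true) ∨
        ∃ w ∈ q.2.2.1, inG w η) (allStr_primrec.comp hN) ?_
    refine PrimrecPred.or (PrimrecPred.or ?_ ?_) ?_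
    · exact Primrec.eq.comp (Primrec.list_getElem?.comp Primrec.fst (hn.comp Primrec.snd))
        (Primrec.const _)
    · refine ex_list (f := fun p : List Bool × Cert => p.2.2.1)
        (R := fun i (p : List Bool × Cert) => p.1[i]? = some true) (hz.comp Primrec.snd) ?_
      exact Primrec.eq.comp (Primrec.list_getElem?.comp (Primrec.fst.comp Primrec.snd) Primrec.fst)
        (Primrec.const _)
    · refine ex_list (f := fun p : List Bool × Cert => p.2.2.2.1)
        (R := fun w (p : List Bool × Cert) => inG w p.1) (hW.comp Primrec.snd) ?_
      exact inG_primrec.comp (Primrec.pair Primrec.fst (Primrec.fst.comp Primrec.snd))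

theorem phi_primrec : PrimrecPred fun p : Cert × ℕ => phi p.1 p.2 := by
  have hW : Primrec fun q : Cert => q.2.2.1 := Primrec.fst.comp (Primrec.snd.comp Primrec.snd)
  unfold phi
  refine PrimrecPred.and ?_ (psi_primrec.comp Primrec.fst)
  refine all_list (f := fun p : Cert × ℕ => p.1.2.2.1)
    (R := fun w (p : Cert × ℕ) => good w p.2) (hW.comp Primrec.fst) ?_
  exact good_primrec.comp (Primrec.pair Primrec.fst (Primrec.snd.comp Primrec.snd))

/-- The c.e. set of refuted certificates. -/
def K : Set ℕ := {c | ∃ t, ¬ phi (Denumerable.ofNat Cert c) t}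

theorem CE_of_primrec {R : ℕ → ℕ → Prop} (h : PrimrecPred fun p : ℕ × ℕ => R p.1 p.2) :
    CE {x | ∃ n, R x n} := by
  classical
  have h := primrecPred_iff_primrec_decide.1 h
  refine ⟨fun x => Nat.rfind fun n => Part.some (decide (R x n)), ?_, ?_⟩
  · apply Partrec.rfind
    exact (h.to_comp.partrec : _)
  · ext x
    refine Iff.trans ?_ (PFun.mem_dom _ _).symm
    constructor
    · rintro ⟨n, hn⟩
      exact ⟨Nat.find ⟨n, hn⟩, Nat.mem_rfind.2
        ⟨Part.mem_some_iff.2 (by simpa using Nat.find_spec ⟨n, hn⟩), fun hm =>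
          Part.mem_some_iff.2 (by simpa using Nat.find_min ⟨n, hn⟩ hm)⟩⟩
    · rintro ⟨n, hn⟩
      have h2 := Part.mem_some_iff.1 (Nat.mem_rfind.1 hn).1
      exact ⟨n, by simpa using h2⟩

theorem mem_raise' (l : List ℕ) : ∀ (n x : ℕ), x ∈ Denumerable.raise' l n ↔
    ∃ i < l.length, x = n + (l.take (i + 1)).foldr (· + ·) 0 + i := by
  induction l with
  | nil => simp [Denumerable.raise']
  | cons a l ih =>
    intro n x
    simp only [Denumerable.raise', List.mem_cons, ih]
    constructor
    · rintro (rfl | ⟨i, hi, rfl⟩)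
      · exact ⟨0, by simp, by simp; omega⟩
      · exact ⟨i + 1, by simpa using hi, by simp; omega⟩
    · rintro ⟨i, hi, rfl⟩
      cases i with
      | zero => left; simp; omega
      | succ i => right; exact ⟨i, by simpa using hi, by simp; omega⟩

theorem mem_Dfin (x y : ℕ) : x ∈ Dfin y ↔
    x ∈ Denumerable.raise' (Denumerable.ofNat (List ℕ) y) 0 := by
  have : Denumerable.ofNat (Finset ℕ) y =
    (Denumerable.raise'Finset (Denumerable.ofNat (List ℕ) y) 0).map
      (Denumerable.eqv ℕ).symm.toEmbedding := rfl
  unfold Dfin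
  rw [this]
  simp [Denumerable.raise'Finset, Denumerable.eqv]
  rfl

theorem memD_primrec : PrimrecPred fun p : ℕ × ℕ => p.1 ∈ Dfin p.2 := by
  have hl : Primrec fun p : ℕ × ℕ => Denumerable.ofNat (List ℕ) p.2 :=
    (Primrec.ofNat _).comp Primrec.snd
  have : PrimrecPred fun p : ℕ × ℕ => ∃ i < (Denumerable.ofNat (List ℕ) p.2).length,
      p.1 = 0 + ((Denumerable.ofNat (List ℕ) p.2).take (i + 1)).foldr (· + ·) 0 + i := by
    refine ex_lt (R := fun i (p : ℕ × ℕ) =>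
      p.1 = 0 + ((Denumerable.ofNat (List ℕ) p.2).take (i + 1)).foldr (· + ·) 0 + i)
      (Primrec.list_length.comp hl) ?_
    refine Primrec.eq.comp (Primrec.fst.comp Primrec.snd) ?_
    refine Primrec.nat_add.comp (Primrec.nat_add.comp (Primrec.const 0) ?_) Primrec.fst
    refine Primrec.list_foldr (h := fun _ q => q.1 + q.2) ?_ (Primrec.const 0) ?_
    · exact Primrec.list_take.comp (Primrec.succ.comp Primrec.fst) (hl.comp Primrec.snd)
    · exact Primrec.nat_add.comp (Primrec.fst.comp Primrec.snd) (Primrec.snd.comp Primrec.snd)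
  refine this.of_eq fun p => ?_
  rw [mem_Dfin, mem_raise']

end TR
namespace TR

theorem exists_Dfin (F : Finset ℕ) : ∃ y, Dfin y = ↑F :=
  ⟨@Encodable.encode _ (Denumerable.finset (α := ℕ)).toEncodable F, by
    unfold Dfin; rw [Denumerable.ofNat_encode]⟩

/-- The join of `A` and `K`. -/
def joinB (A : ℕ → Bool) : Set ℕ :=
  {x | (x % 2 = 0 ∧ A (x / 2) = true) ∨ (x % 2 = 1 ∧ x / 2 ∈ K)}

theorem CE_pair {R : ℕ → ℕ → ℕ → Prop}
    (h : PrimrecPred fun p : (ℕ × ℕ) × ℕ => R p.1.1 p.1.2 p.2) :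
    CE {p : ℕ | ∃ n, R p.unpair.1 p.unpair.2 n} := by
  apply CE_of_primrec (R := fun p n => R p.unpair.1 p.unpair.2 n)
  exact h.comp (f := fun p : ℕ × ℕ => (p.1.unpair, p.2))
    (Primrec.pair (Primrec.unpair.comp Primrec.fst) Primrec.snd)

theorem red_of {A B : Set ℕ} (R : ℕ → ℕ → ℕ → Prop)
    (h : PrimrecPred fun p : (ℕ × ℕ) × ℕ => R p.1.1 p.1.2 p.2)
    (h1 : ∀ x ∈ A, ∃ y n, R x y n ∧ Dfin y ⊆ B)
    (h2 : ∀ x y n, R x y n → Dfin y ⊆ B → x ∈ A) : EnumRed A B := by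
  refine ⟨_, CE_pair h, ?_⟩
  ext x
  simp only [enumOp, Set.mem_ofPred_eq, Nat.unpair_pair]
  constructor
  · intro hx
    obtain ⟨y, n, hR, hy⟩ := h1 x hx
    exact ⟨y, ⟨n, hR⟩, hy⟩
  · rintro ⟨y, ⟨n, hR⟩, hy⟩
    exact h2 x y n hR hy

theorem px : Primrec fun p : (ℕ × ℕ) × ℕ => p.1.1 := Primrec.fst.comp Primrec.fst
theorem py : Primrec fun p : (ℕ × ℕ) × ℕ => p.1.2 := Primrec.snd.comp Primrec.fst
theorem pn : Primrec fun p : (ℕ × ℕ) × ℕ => p.2 := Primrec.snd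
theorem phalf : Primrec fun p : (ℕ × ℕ) × ℕ => p.1.1 / 2 :=
  Primrec.nat_div.comp px (Primrec.const 2)
theorem pmod (i : ℕ) : PrimrecPred fun p : (ℕ × ℕ) × ℕ => p.1.1 % 2 = i :=
  Primrec.eq.comp (Primrec.nat_mod.comp px (Primrec.const 2)) (Primrec.const i)
theorem pphi : PrimrecPred fun p : (ℕ × ℕ) × ℕ =>
    ¬ phi (Denumerable.ofNat Cert (p.1.1 / 2)) p.2 :=
  (phi_primrec.comp (Primrec.pair ((Primrec.ofNat Cert).comp phalf) pn)).not

theorem red1 (A : ℕ → Bool) : EnumRed (toSet A) (joinB A) := by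
  refine red_of (fun x y _ => 2 * x ∈ Dfin y) ?_ ?_ ?_
  · exact memD_primrec.comp (Primrec.pair (Primrec.nat_mul.comp (Primrec.const 2) px) py)
  · intro x hx
    obtain ⟨y, hy⟩ := exists_Dfin {2 * x}
    refine ⟨y, 0, by simp [hy], ?_⟩
    rw [hy]
    simpa [joinB, toSet] using hx
  · intro x y n h hy
    have := hy h
    simpa [joinB, toSet] using this

theorem red2 (A : ℕ → Bool) : EnumRed (joinB A) (toSet A) := by
  refine red_of (fun x y n => (x % 2 = 0 ∧ x / 2 ∈ Dfin y) ∨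
    (x % 2 = 1 ∧ ¬ phi (Denumerable.ofNat Cert (x / 2)) n)) ?_ ?_ ?_
  · exact ((pmod 0).and (memD_primrec.comp (Primrec.pair phalf py))).or ((pmod 1).and pphi)
  · rintro x (⟨h, hx⟩ | ⟨h, t, ht⟩)
    · obtain ⟨y, hy⟩ := exists_Dfin {x / 2}
      refine ⟨y, 0, Or.inl ⟨h, by simp [hy]⟩, ?_⟩
      rw [hy]
      simpa [toSet] using hx
    · obtain ⟨y, hy⟩ := exists_Dfin ∅
      exact ⟨y, t, Or.inr ⟨h, ht⟩, by simp [hy]⟩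
  · rintro x y n (⟨h, hx⟩ | ⟨h, ht⟩) hy
    · exact Or.inl ⟨h, hy hx⟩
    · exact Or.inr ⟨h, n, ht⟩

theorem red3 (A : ℕ → Bool) (hA : ∀ n, A n = true ↔ ∃ q : Cert, q.1 = n ∧
    (∀ i ∈ q.2.1, A i = false) ∧ ∀ t, phi q t) : Cototal (joinB A) := by
  refine red_of (fun x y n => (x % 2 = 0 ∧ ((Denumerable.ofNat Cert n).1 = x / 2 ∧
      (∀ i ∈ (Denumerable.ofNat Cert n).2.1, 2 * i ∈ Dfin y) ∧ 2 * n + 1 ∈ Dfin y)) ∨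
    (x % 2 = 1 ∧ ¬ phi (Denumerable.ofNat Cert (x / 2)) n)) ?_ ?_ ?_
  · have hc : Primrec fun p : (ℕ × ℕ) × ℕ => Denumerable.ofNat Cert p.2 :=
      (Primrec.ofNat Cert).comp pn
    refine ((pmod 0).and (PrimrecPred.and ?_ (PrimrecPred.and ?_ ?_))).or ((pmod 1).and pphi)
    · exact Primrec.eq.comp (Primrec.fst.comp hc) phalf
    · refine all_list (f := fun p : (ℕ × ℕ) × ℕ => (Denumerable.ofNat Cert p.2).2.1)
        (R := fun i (p : (ℕ × ℕ) × ℕ) => 2 * i ∈ Dfin p.1.2)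
        (Primrec.fst.comp (Primrec.snd.comp hc)) ?_
      exact memD_primrec.comp (Primrec.pair (Primrec.nat_mul.comp (Primrec.const 2) Primrec.fst)
        (py.comp Primrec.snd))
    · exact memD_primrec.comp (Primrec.pair (Primrec.succ.comp
        (Primrec.nat_mul.comp (Primrec.const 2) pn)) py)
  · rintro x (⟨h, hx⟩ | ⟨h, t, ht⟩)
    · obtain ⟨q, hq, hz, ht⟩ := (hA _).1 hx
      obtain ⟨y, hy⟩ := exists_Dfin
        (insert (2 * Encodable.encode q + 1) (q.2.1.map (2 * ·)).toFinset)
      refine ⟨y, Encodable.encode q, Or.inl ⟨h, ?_, ?_, ?_⟩, ?_⟩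
      · rw [Denumerable.ofNat_encode]; exact hq
      · rw [Denumerable.ofNat_encode, hy]
        intro i hi
        simp only [Finset.coe_insert, List.coe_toFinset, Set.mem_insert_iff, Set.mem_ofPred_eq,
          List.mem_map]
        exact Or.inr ⟨i, hi, rfl⟩
      · rw [hy]; simp
      · rw [hy]
        intro a ha
        simp only [Finset.coe_insert, List.coe_toFinset, Set.mem_insert_iff, Set.mem_ofPred_eq,
          List.mem_map] at ha
        rcases ha with rfl | ⟨i, hi, rfl⟩
        · rintro (⟨h1, _⟩ | ⟨_, t, h2⟩)
          · omega
          · have : (2 * Encodable.encode q + 1) / 2 = Encodable.encode q := by omega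
            rw [this, Denumerable.ofNat_encode] at h2
            exact h2 (ht t)
        · rintro (⟨_, h1⟩ | ⟨h2, _⟩)
          · have : (2 * i) / 2 = i := by omega
            rw [this, hz i hi] at h1
            simp at h1
          · omega
    · obtain ⟨y, hy⟩ := exists_Dfin ∅
      exact ⟨y, t, Or.inr ⟨h, ht⟩, by simp [hy]⟩
  · rintro x y n (⟨h, h1, h2, h3⟩ | ⟨h, ht⟩) hy
    · refine Or.inl ⟨h, (hA _).2 ⟨Denumerable.ofNat Cert n, h1, ?_, ?_⟩⟩
      · intro i hi
        have h4 := hy (h2 i hi)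
        by_contra h5
        apply h4
        left
        have : (2 * i) / 2 = i := by omega
        rw [this]
        exact ⟨by omega, by simpa using h5⟩
      · intro t
        have h4 := hy h3
        by_contra h5
        apply h4
        right
        have : (2 * n + 1) / 2 = n := by omega
        rw [this]
        exact ⟨by omega, t, h5⟩
    · exact Or.inr ⟨h, n, ht⟩

end TR
namespace TR
open Nat.Partrec (Code)
open Filter Topology
open scoped ENNReal

theorem res_length (X : ℕ → Bool) (n : ℕ) : (res X n).length = n := by simp [res]

theorem res_get? (X : ℕ → Bool) (n i : ℕ) : (res X n)[i]? = if i < n then some (X i) else none := by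
  simp [res, List.getElem?_ofFn]

theorem res_take (X : ℕ → Bool) {j n : ℕ} (h : j ≤ n) : (res X n).take j = res X j := by
  apply List.ext_getElem?
  intro i
  rw [List.getElem?_take, res_get?, res_get?]
  split_ifs <;> first | rfl | omega

theorem mem_cyl {X : ℕ → Bool} {σ : List Bool} : X ∈ cyl σ ↔ res X σ.length = σ := by
  constructor
  · intro h
    apply List.ext_getElem (res_length _ _)
    intro i h1 h2
    simpa [res] using h ⟨i, h2⟩
  · intro h i
    have := res_get? X σ.length i
    rw [h] at this
    simpa using this.symm

theorem exists_res (σ : List Bool) : ∃ X, res X σ.length = σ := by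
  refine ⟨fun i => σ.getD i false, ?_⟩
  apply List.ext_getElem (res_length _ _)
  intro i h1 h2
  simp [res, h2]

theorem cyl_clopen (σ : List Bool) : IsOpen (cyl σ) := by
  have : cyl σ = ⋂ i : Fin σ.length, (fun X : ℕ → Bool => X i) ⁻¹' {σ.get i} := by
    ext X; simp [cyl]
  rw [this]
  exact isOpen_iInter_of_finite fun i => (isOpen_discrete _).preimage (continuous_apply _)

theorem cyl_meas (σ : List Bool) : MeasurableSet (cyl σ) := by
  have : cyl σ = ⋂ i : Fin σ.length, (fun X : ℕ → Bool => X i) ⁻¹' {σ.get i} := by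
    ext X; simp [cyl]
  rw [this]
  exact MeasurableSet.iInter fun i => measurable_pi_apply _ (measurableSet_singleton _)

open Classical in
theorem set_eq (P : List Bool → Prop) (n : ℕ) : {X | P (res X n)} =
    ⋃ σ ∈ ((allStr n).filter (fun η => P η)).toFinset, cyl σ := by
  ext X
  simp only [Set.mem_ofPred_eq, Set.mem_iUnion, List.mem_toFinset, List.mem_filter, mem_allStr,
    decide_eq_true_eq, mem_cyl, exists_prop]
  constructor
  · intro h
    exact ⟨res X n, ⟨res_length _ _, h⟩, by rw [res_length]⟩
  · rintro ⟨σ, ⟨rfl, h⟩, h2⟩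
    rw [h2]; exact h

theorem set_open (P : List Bool → Prop) (n : ℕ) : IsOpen {X | P (res X n)} := by
  rw [set_eq]
  exact isOpen_biUnion fun σ _ => cyl_clopen σ

theorem set_meas (P : List Bool → Prop) (n : ℕ) : MeasurableSet {X | P (res X n)} := by
  rw [set_eq]
  exact Finset.measurableSet_biUnion _ fun σ _ => cyl_meas σ

/-- The clopen set described by `w`. -/
def Gset (w : ℕ × ℕ × ℕ) : Set (ℕ → Bool) := {X | inG w (res X w.2.2)}

theorem inG_iff {w : ℕ × ℕ × ℕ} {X : ℕ → Bool} {N : ℕ} (h : w.2.2 ≤ N) :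
    inG w (res X N) ↔ X ∈ Gset w := by
  simp only [Gset, Set.mem_ofPred_eq, inG]
  refine exists_congr fun k' => and_congr_right fun _ => forall_congr' fun j =>
    forall_congr' fun hj => ?_
  rw [res_take X (by omega : j ≤ N), res_take X (by omega : j ≤ w.2.2)]

theorem mem_Gset {e k s : ℕ} {X : ℕ → Bool} : X ∈ Gset (e, k, s) ↔
    ∃ k' ≤ k, ∀ j ≤ s, Qb e (e + 3) k' (res X j) s := by
  simp only [Gset, Set.mem_ofPred_eq, inG]
  refine exists_congr fun k' => and_congr Nat.lt_succ_iff <| forall_congr' fun j =>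
    ⟨fun h hj => ?_, fun h hj => ?_⟩
  · rw [← res_take X hj]; exact h (by omega)
  · rw [res_take X (by omega : j ≤ s)]; exact h (by omega)

theorem Qb_anti {e m k : ℕ} {σ : List Bool} {s t : ℕ} (h : s ≤ t) (hq : Qb e m k σ t) :
    Qb e m k σ s := fun h2 => hq (Code.evaln_mono h h2)

theorem G_anti (e k : ℕ) : Antitone fun s => Gset (e, k, s) := by
  intro s t h X hX
  obtain ⟨k', hk, h2⟩ := mem_Gset.1 hX
  exact mem_Gset.2 ⟨k', hk, fun j hj => Qb_anti h (h2 j (hj.trans h))⟩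

theorem G_mono (e s : ℕ) : Monotone fun k => Gset (e, k, s) := by
  intro k l h X hX
  obtain ⟨k', hk, h2⟩ := mem_Gset.1 hX
  exact mem_Gset.2 ⟨k', hk.trans h, h2⟩

theorem G_meas (w : ℕ × ℕ × ℕ) : MeasurableSet (Gset w) := set_meas _ _
theorem G_open (w : ℕ × ℕ × ℕ) : IsOpen (Gset w) := set_open _ _

theorem G_measure {μ : Measure (ℕ → Bool)} (hμ : IsCoinMeasure μ) (w : ℕ × ℕ × ℕ) :
    μ (Gset w) = ENNReal.ofReal (cnt w * (2⁻¹) ^ w.2.2) := by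
  classical
  unfold Gset
  rw [set_eq, measure_biUnion_finset]
  · rw [Finset.sum_congr rfl (g := fun _ => (2⁻¹ : ℝ≥0∞) ^ w.2.2)]
    · rw [Finset.sum_const, List.toFinset_card_of_nodup ((nodup_allStr _).filter _),
        ENNReal.ofReal_mul (by positivity), ENNReal.ofReal_pow (by positivity),
        ENNReal.ofReal_inv_of_pos (by norm_num)]
      simp [cnt]
    · intro σ hσ
      simp only [List.mem_toFinset, List.mem_filter, mem_allStr] at hσ
      rw [hμ, hσ.1]
  · intro σ hσ τ hτ hne
    simp only [Finset.mem_coe, List.mem_toFinset, List.mem_filter, mem_allStr] at hσ hτ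
    rw [Function.onFun, Set.disjoint_left]
    intro X h1 h2
    rw [mem_cyl] at h1 h2
    apply hne
    rw [← h1, ← h2, hσ.1, hτ.1]
  · exact fun σ _ => cyl_meas σ

theorem ofReal_half (n : ℕ) : (2⁻¹ : ℝ≥0∞) ^ n = ENNReal.ofReal ((2⁻¹) ^ n) := by
  rw [ENNReal.ofReal_pow (by positivity), ENNReal.ofReal_inv_of_pos (by norm_num)]
  simp

/-- Abstract goodness. -/
def Good (μ : Measure (ℕ → Bool)) (c : ℝ≥0∞) (G : ℕ → ℕ → Set (ℕ → Bool)) (k s : ℕ) : Prop :=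
  μ (G k s) ≤ 2 * c ∧ ∀ t, s ≤ t → μ (G k s) ≤ μ (G k t) + c * 2⁻¹ ^ (k + 1)

theorem good_iff {μ : Measure (ℕ → Bool)} (hμ : IsCoinMeasure μ) (e k s : ℕ) :
    (∀ t, good (e, k, s) t) ↔ Good μ (2⁻¹ ^ (e + 3)) (fun k s => Gset (e, k, s)) k s := by
  have h1 : cnt (e, k, s) * 2 ^ (e + 3) ≤ 2 ^ (s + 1) ↔
      μ (Gset (e, k, s)) ≤ 2 * 2⁻¹ ^ (e + 3) := by
    rw [G_measure hμ, ofReal_half, show (2 : ℝ≥0∞) = ENNReal.ofReal 2 by simp,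
      ← ENNReal.ofReal_mul (by norm_num), ENNReal.ofReal_le_ofReal_iff (by positivity),
      ← @Nat.cast_le ℝ]
    push_cast
    rw [inv_pow, inv_pow, ← div_eq_mul_inv, ← div_eq_mul_inv, div_le_div_iff₀ (by positivity)
      (by positivity), pow_succ 2 s, mul_comm (2 ^ s : ℝ) 2]
  have h2 (t : ℕ) : cnt (e, k, s) * 2 ^ t * 2 ^ (e + k + 4) ≤
      cnt (e, k, t) * 2 ^ s * 2 ^ (e + k + 4) + 2 ^ s * 2 ^ t ↔
      μ (Gset (e, k, s)) ≤ μ (Gset (e, k, t)) + 2⁻¹ ^ (e + 3) * 2⁻¹ ^ (k + 1) := by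
    rw [← pow_add (2⁻¹ : ℝ≥0∞), show e + 3 + (k + 1) = e + k + 4 by ring]
    rw [G_measure hμ, G_measure hμ, ofReal_half, ← ENNReal.ofReal_add (by positivity)
      (by positivity), ENNReal.ofReal_le_ofReal_iff (by positivity),
      ← @Nat.cast_le ℝ]
    push_cast
    have hs : (0 : ℝ) < 2 ^ s := by positivity
    have ht : (0 : ℝ) < 2 ^ t := by positivity
    have hp : (0 : ℝ) < 2 ^ (e + k + 4) := by positivity
    rw [inv_pow, inv_pow, inv_pow]
    generalize (2 : ℝ) ^ s = a at *
    generalize (2 : ℝ) ^ t = b at *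
    generalize (2 : ℝ) ^ (e + k + 4) = p at *
    have e1 : (cnt (e, k, s) : ℝ) * a⁻¹ * (a * b * p) = cnt (e, k, s) * b * p := by field_simp
    have e2 : ((cnt (e, k, t) : ℝ) * b⁻¹ + p⁻¹) * (a * b * p) =
      cnt (e, k, t) * a * p + a * b := by field_simp
    rw [← e1, ← e2, mul_le_mul_iff_left₀ (mul_pos (mul_pos hs ht) hp)]
  unfold good Good
  constructor
  · intro h
    refine ⟨h1.1 (h 0).1, fun t ht => (h2 t).1 ?_⟩
    rcases (h t).2 with h3 | h3
    · exact absurd ht (not_le.2 h3)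
    · exact h3
  · rintro ⟨h3, h4⟩ t
    refine ⟨h1.2 h3, ?_⟩
    rcases lt_or_ge t s with h5 | h5
    · exact Or.inl h5
    · exact Or.inr ((h2 t).2 (h4 t h5))

theorem tend {μ : Measure (ℕ → Bool)} [IsFiniteMeasure μ] {G : ℕ → Set (ℕ → Bool)}
    (hm : ∀ s, MeasurableSet (G s)) (ha : Antitone G) :
    Tendsto (fun s => μ (G s)) atTop (𝓝 (μ (⋂ s, G s))) :=
  tendsto_measure_iInter_atTop (fun s => (hm s).nullMeasurableSet) ha ⟨0, measure_ne_top _ _⟩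

theorem small {μ : Measure (ℕ → Bool)} [IsFiniteMeasure μ] (c : ℝ≥0∞)
    {G : ℕ → ℕ → Set (ℕ → Bool)}
    (hm : ∀ k s, MeasurableSet (G k s)) (ha : ∀ k, Antitone (G k))
    (hmono : ∀ s, Monotone fun k => G k s) :
    μ (⋃ k, ⋃ s : {s // Good μ c G k s}, G k s) ≤ 3 * c := by
  set I : ℕ → Set (ℕ → Bool) := fun k => ⋂ s, G k s with hI
  have hImono : Monotone I := fun k l h => Set.iInter_mono fun s => hmono s h
  have hsub : (⋃ k, ⋃ s : {s // Good μ c G k s}, G k s) ⊆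
      (⋃ k, ⋃ s : {s // Good μ c G k s}, G k s \ I k) ∪
      ⋃ k : {k // ∃ s, Good μ c G k s}, I k := by
    intro X hX
    simp only [Set.mem_iUnion] at hX
    obtain ⟨k, s, h⟩ := hX
    by_cases hk : X ∈ I k
    · exact Or.inr (Set.mem_iUnion.2 ⟨⟨k, s, s.2⟩, hk⟩)
    · exact Or.inl (Set.mem_iUnion.2 ⟨k, Set.mem_iUnion.2 ⟨s, h, hk⟩⟩)
  refine (measure_mono hsub).trans ((measure_union_le _ _).trans ?_)
  rw [show (3 : ℝ≥0∞) = 1 + 2 by norm_num, add_mul]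
  refine add_le_add ?_ ?_
  · refine (measure_iUnion_le _).trans ?_
    have : ∀ k, μ (⋃ s : {s // Good μ c G k s}, G k s \ I k) ≤ c * 2⁻¹ ^ (k + 1) := by
      intro k
      rw [Directed.measure_iUnion]
      · refine iSup_le fun s => ?_
        rw [measure_sdiff (Set.iInter_subset _ _)
          (MeasurableSet.iInter fun s => hm k s).nullMeasurableSet (measure_ne_top _ _)]
        rw [tsub_le_iff_left]
        refine ge_of_tendsto ((tend (hm k) (ha k)).add_const _) ?_
        filter_upwards [eventually_ge_atTop (s : ℕ)] with t ht
        exact s.2.2 t ht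
      · refine directed_of_isDirected_ge ?_
        intro s t h
        exact Set.sdiff_subset_sdiff_left (ha k h)
    refine (ENNReal.tsum_le_tsum this).trans ?_
    rw [ENNReal.tsum_mul_left, mul_comm]
    gcongr
    rw [ENNReal.tsum_geometric_add_one]
    rw [ENNReal.one_sub_inv_two, inv_inv, ENNReal.inv_mul_cancel] <;> simp
  · rw [Directed.measure_iUnion]
    · refine iSup_le fun k => ?_
      obtain ⟨k, s, hs⟩ := k
      exact (measure_mono (Set.iInter_subset _ s)).trans hs.1
    · refine directed_of_isDirected_le ?_
      intro s t h
      exact hImono h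

theorem exists_good {μ : Measure (ℕ → Bool)} [IsFiniteMeasure μ] {c : ℝ≥0∞} (hc : c ≠ 0)
    (hc' : c ≠ ∞) {G : ℕ → ℕ → Set (ℕ → Bool)}
    (hm : ∀ k s, MeasurableSet (G k s)) (ha : ∀ k, Antitone (G k)) (k : ℕ)
    (h : μ (⋂ s, G k s) ≤ c) : ∃ s, Good μ c G k s := by
  have hε : c * 2⁻¹ ^ (k + 1) ≠ 0 := by
    simp [hc]
  have hlt : μ (⋂ s, G k s) < μ (⋂ s, G k s) + c * 2⁻¹ ^ (k + 1) :=
    ENNReal.lt_add_right (measure_ne_top _ _) hε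
  obtain ⟨s, hs⟩ := ((tend (hm k) (ha k)).eventually_lt_const hlt).exists
  refine ⟨s, ?_, fun t _ => hs.le.trans ?_⟩
  · refine hs.le.trans ?_
    rw [two_mul]
    refine add_le_add h ?_
    calc c * 2⁻¹ ^ (k + 1) ≤ c * 1 := by
          gcongr
          exact pow_le_one₀ (by simp) (by simp)
      _ = c := mul_one c
  · gcongr
    exact Set.iInter_subset _ t

/-- The universal open set. -/
def U : Set (ℕ → Bool) := ⋃ w : {w : ℕ × ℕ × ℕ // ∀ t, good w t}, Gset w

theorem isProb {μ : Measure (ℕ → Bool)} (hμ : IsCoinMeasure μ) : IsProbabilityMeasure μ := by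
  constructor
  have := hμ []
  have h2 : cyl [] = Set.univ := by ext X; simp [mem_cyl, res]
  simpa [h2] using this

theorem U_measure {μ : Measure (ℕ → Bool)} (hμ : IsCoinMeasure μ) : μ U < 1 := by
  have := isProb hμ
  have hsub : U ⊆ ⋃ e : ℕ, ⋃ k, ⋃ s : {s // Good μ (2⁻¹ ^ (e + 3))
      (fun k s => Gset (e, k, s)) k s}, Gset (e, k, s) := by
    intro X hX
    obtain ⟨⟨⟨e, k, s⟩, hw⟩, hX⟩ := Set.mem_iUnion.1 hX
    exact Set.mem_iUnion.2 ⟨e, Set.mem_iUnion.2 ⟨k, Set.mem_iUnion.2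
      ⟨⟨s, (good_iff hμ e k s).1 hw⟩, hX⟩⟩⟩
  have h1 : μ U ≤ ∑' e : ℕ, 3 * 2⁻¹ ^ (e + 3) := by
    refine (measure_mono hsub).trans ((measure_iUnion_le _).trans ?_)
    exact ENNReal.tsum_le_tsum fun e => small (G := fun k s => Gset (e, k, s)) _
      (fun k s => G_meas _) (fun k => G_anti e k) (fun s => G_mono e s)
  refine h1.trans_lt ?_
  have h2 : ∑' e : ℕ, (3 * 2⁻¹ ^ (e + 3) : ℝ≥0∞) = ENNReal.ofReal (3 / 4) := by
    simp_rw [pow_succ]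
    rw [ENNReal.tsum_mul_left, ENNReal.tsum_mul_right, ENNReal.tsum_mul_right,
      ENNReal.tsum_mul_right, ENNReal.tsum_geometric, ENNReal.one_sub_inv_two, inv_inv,
      show (2⁻¹ : ℝ≥0∞) = ENNReal.ofReal (2⁻¹) by
        rw [ENNReal.ofReal_inv_of_pos (by norm_num)]; simp,
      show (2 : ℝ≥0∞) = ENNReal.ofReal 2 by simp, show (3 : ℝ≥0∞) = ENNReal.ofReal 3 by simp,
      ← ENNReal.ofReal_mul (by norm_num), ← ENNReal.ofReal_mul (by norm_num),
      ← ENNReal.ofReal_mul (by norm_num), ← ENNReal.ofReal_mul (by norm_num)]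
    norm_num
  rw [h2, ← ENNReal.ofReal_one]
  exact (ENNReal.ofReal_lt_ofReal_iff (by norm_num)).2 (by norm_num)

theorem U_open : IsOpen U := isOpen_iUnion fun w => G_open _

theorem exists_code_test {R : ℕ → ℕ → List Bool → Bool}
    (hR : Computable (fun p : ℕ × ℕ × List Bool => R p.1 p.2.1 p.2.2)) :
    ∃ e : ℕ, ∀ m k σ, (∀ t, Qb e m k σ t) ↔ R m k σ = true := by
  obtain ⟨c, hc⟩ := Code.exists_code.1 (show Nat.Partrec _ from hR)
  refine ⟨Encodable.encode c, fun m k σ => ?_⟩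
  have hv : Code.eval c (Encodable.encode (m, k, σ)) = Part.some (Encodable.encode (R m k σ)) := by
    rw [hc]
    simp
  unfold Qb
  rw [Denumerable.ofNat_encode]
  constructor
  · intro h
    by_contra hn
    have hf : R m k σ = false := by simpa using hn
    rw [hf] at hv
    have : Encodable.encode false ∈ Code.eval c (Encodable.encode (m, k, σ)) := by
      rw [hv]; exact Part.mem_some _
    obtain ⟨t, ht⟩ := Code.evaln_complete.1 this
    exact h t ht
  · intro h t ht
    have := Code.evaln_sound (Option.mem_def.2 ht)
    rw [hv, Part.mem_some_iff, h] at this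
    simpa using Encodable.encode_injective this

theorem twoRandom_of {μ : Measure (ℕ → Bool)} (hμ : IsCoinMeasure μ) {A : ℕ → Bool} (hA : A ∉ U) :
    TwoRandom μ A := by
  have := isProb hμ
  intro R hR hm
  obtain ⟨e, he⟩ := exists_code_test hR
  refine ⟨e + 3, fun hmem => hA ?_⟩
  obtain ⟨k, hk⟩ := hmem
  have hI : (⋂ s, Gset (e, k, s)) ⊆ {A | ∃ k, ∀ j, R (e + 3) k (res A j) = true} := by
    intro X hX
    rw [Set.mem_iInter] at hX
    by_contra hn
    have hn' : ∀ k', ∃ j, ∃ t, ¬ Qb e (e + 3) k' (res X j) t := by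
      intro k'
      by_contra h1
      push Not at h1
      exact hn ⟨k', fun j => (he _ _ _).1 (h1 j)⟩
    choose j t hjt using hn'
    set M := (Finset.range (k + 1)).sup (fun k' => max (j k') (t k')) with hM
    obtain ⟨k', hk', h2⟩ := mem_Gset.1 (hX M)
    have h3 : max (j k') (t k') ≤ M :=
      Finset.le_sup (f := fun k' => max (j k') (t k')) (Finset.mem_range.2 (by omega))
    exact hjt k' (Qb_anti ((le_max_right _ _).trans h3) (h2 _ ((le_max_left _ _).trans h3)))
  obtain ⟨s, hs⟩ := exists_good (μ := μ) (c := 2⁻¹ ^ (e + 3)) (by simp)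
    (by simp) (G := fun k s => Gset (e, k, s)) (fun k s => G_meas _) (fun k => G_anti e k) k
    ((measure_mono hI).trans (hm _))
  refine Set.mem_iUnion.2 ⟨⟨(e, k, s), (good_iff hμ e k s).2 hs⟩, ?_⟩
  exact mem_Gset.2 ⟨k, le_rfl, fun j _ => (he _ _ _).2 (hk j) s⟩

/-- The real represented by a point of Cantor space. -/
noncomputable def val (X : ℕ → Bool) : ℝ := ∑' i, if X i = true then ((1 : ℝ) / 2) ^ i else 0

theorem val_bd (X : ℕ → Bool) (i : ℕ) :
    ‖(if X i = true then ((1 : ℝ) / 2) ^ i else 0)‖ ≤ (1 / 2) ^ i := by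
  split_ifs
  · rw [Real.norm_of_nonneg (by positivity)]
  · simp

theorem val_summable (X : ℕ → Bool) : Summable fun i => if X i = true then ((1 : ℝ) / 2) ^ i else 0 :=
  Summable.of_norm_bounded summable_geometric_two (val_bd X)

theorem val_cont : Continuous val := by
  refine continuous_tsum (fun i => ?_) summable_geometric_two (fun i X => val_bd X i)
  exact (continuous_of_discreteTopology (f := fun b : Bool =>
    if b = true then ((1 : ℝ) / 2) ^ i else 0)).comp (continuous_apply i)

theorem val_lt {X A : ℕ → Bool} {n : ℕ} (h : ∀ i, A i = false → X i = false) (hX : X n = false)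
    (hA : A n = true) : val X < val A := by
  refine Summable.tsum_lt_tsum (i := n) ?_ ?_ (val_summable X) (val_summable A)
  · intro i
    cases hi : A i
    · simp [h i hi, hi]
    · simp only [hi, if_true]
      split_ifs
      · exact le_rfl
      · positivity
  · simp [hX, hA]

theorem exists_min {μ : Measure (ℕ → Bool)} (hμ : IsCoinMeasure μ) :
    ∃ A, A ∉ U ∧ ∀ X, X ∉ U → val A ≤ val X := by
  have := isProb hμ
  have hne : (Uᶜ : Set (ℕ → Bool)).Nonempty := by
    rw [Set.nonempty_compl]
    intro h
    have := U_measure hμ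
    simp [h] at this
  obtain ⟨A, hA, hmin⟩ := (U_open.isClosed_compl.isCompact).exists_isMinOn hne val_cont.continuousOn
  exact ⟨A, hA, fun X hX => hmin hX⟩

theorem cert_iff {A : ℕ → Bool} (hA : A ∉ U) (hmin : ∀ X, X ∉ U → val A ≤ val X) (n : ℕ) :
    A n = true ↔ ∃ q : Cert, q.1 = n ∧ (∀ i ∈ q.2.1, A i = false) ∧ ∀ t, phi q t := by
  constructor
  · intro hn
    have hcl (i : ℕ) : IsClosed {X : ℕ → Bool | X i = false} :=
      isClosed_eq (continuous_apply i) continuous_const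
    set V : ℕ → Set (ℕ → Bool) := fun N =>
      {X | X n = false} ∩ ⋂ i, ⋂ (_ : i < N ∧ A i = false), {X | X i = false} with hV
    have hVc (N : ℕ) : IsClosed (V N) :=
      (hcl n).inter (isClosed_iInter fun i => isClosed_iInter fun _ => hcl i)
    have hVa : Antitone V := by
      intro N M h X hX
      refine ⟨hX.1, ?_⟩
      have h2 := hX.2
      simp only [Set.mem_iInter] at h2 ⊢
      exact fun i hi => h2 i ⟨by omega, hi.2⟩
    have hVU : (⋂ N, V N) ⊆ U := by
      intro X hX
      rw [Set.mem_iInter] at hX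
      by_contra hXU
      have h1 : ∀ i, A i = false → X i = false := by
        intro i hi
        have := (hX (i + 1)).2
        simp only [Set.mem_iInter] at this
        exact this i ⟨by omega, hi⟩
      exact absurd (val_lt h1 (hX 0).1 hn) (not_lt.2 (hmin X hXU))
    obtain ⟨F, hF⟩ := (isClosed_iInter hVc).isCompact.elim_finite_subcover
      (fun w : {w : ℕ × ℕ × ℕ // ∀ t, good w t} => Gset w) (fun w => G_open _) hVU
    have hop : IsOpen (⋃ w ∈ F, Gset w) := isOpen_biUnion fun w _ => G_open _
    obtain ⟨N, hN⟩ := exists_subset_nhds_of_isCompact' (V := V)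
      (directed_of_isDirected_le hVa)
      (fun N => (hVc N).isCompact) hVc (fun X hX => hop.mem_nhds (hF hX))
    set W : List (ℕ × ℕ × ℕ) := F.toList.map (fun w => w.1) with hW
    set M := max (max N (n + 1)) (F.sup fun w => w.1.2.2) with hM
    refine ⟨(n, (List.range M).filter (fun i => A i = false), W, M), rfl, ?_, fun t => ⟨?_, ?_, ?_⟩⟩
    · intro i hi
      simpa using (List.mem_filter.1 hi).2
    · intro w hw
      obtain ⟨v, _, rfl⟩ := List.mem_map.1 hw
      exact v.2 t
    · intro w hw
      obtain ⟨v, hv, rfl⟩ := List.mem_map.1 hw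
      have : v.1.2.2 ≤ F.sup fun w => w.1.2.2 :=
        Finset.le_sup (f := fun w : {w : ℕ × ℕ × ℕ // ∀ t, good w t} => w.1.2.2)
          (Finset.mem_toList.1 hv)
      exact Nat.lt_succ_of_le (this.trans (le_max_right _ _))
    · intro η hη
      have hη' : η.length = M := mem_allStr.1 hη
      obtain ⟨X, hX⟩ := exists_res η
      rw [hη'] at hX
      subst hX
      by_cases hXV : X ∈ V N
      · right
        have h3 := hN hXV
        simp only [Set.mem_iUnion] at h3
        obtain ⟨v, hv, h4⟩ := h3
        refine ⟨v.1, List.mem_map.2 ⟨v, Finset.mem_toList.2 hv, rfl⟩, (inG_iff ?_).2 h4⟩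
        have : v.1.2.2 ≤ F.sup fun w => w.1.2.2 :=
          Finset.le_sup (f := fun w : {w : ℕ × ℕ × ℕ // ∀ t, good w t} => w.1.2.2) hv
        exact this.trans (le_max_right _ _)
      · left
        have hNM : N ≤ M := (le_max_left _ _).trans (le_max_left _ _)
        have hnM : n < M := (le_max_right N (n + 1)).trans (le_max_left _ _)
        simp only [res_get?]
        by_contra hcon
        push Not at hcon
        apply hXV
        refine ⟨?_, ?_⟩
        · have := hcon.1
          simpa [hnM] using this
        · simp only [Set.mem_iInter]
          intro i hi
          have hiM : i < M := hi.1.trans_le hNM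
          have := hcon.2 i (List.mem_filter.2 ⟨List.mem_range.2 hiM, by simp [hi.2]⟩)
          simpa [hiM] using this
  · rintro ⟨⟨n', z, W, N⟩, rfl, hz, hφ⟩
    by_contra hn
    obtain ⟨_, hs, hη⟩ := hφ 0
    rcases hη (res A N) (mem_allStr.2 (res_length _ _)) with (h | ⟨i, hi, h⟩) | ⟨w, hw, h⟩
    · rw [res_get?] at h
      split_ifs at h
      exact hn (by simpa using h)
    · rw [res_get?] at h
      split_ifs at h
      have := hz i hi
      simp_all
    · refine hA (Set.mem_iUnion.2 ⟨⟨w, fun t => (hφ t).1 w hw⟩, ?_⟩)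
      exact (inG_iff (Nat.lt_succ_iff.1 (hs w hw))).1 h

end TR
/-- There exists a 2-random set of cototal enumeration degree. -/
theorem stmt_15 (μ : Measure (ℕ → Bool)) (hμ : IsCoinMeasure μ) :
    ∃ A : ℕ → Bool, TwoRandom μ A ∧
      ∃ B : Set ℕ, EnumEquiv (toSet A) B ∧ Cototal B := by
  obtain ⟨A, hA, hmin⟩ := TR.exists_min hμ
  exact ⟨A, TR.twoRandom_of hμ hA, TR.joinB A, ⟨TR.red1 A, TR.red2 A⟩,
    TR.red3 A (TR.cert_iff hA hmin)⟩
end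

section
/- No weakly 3-random set has introenumerable enumeration degree. -/
open MeasureTheory

namespace Intro17

/-- Flip the `n`-th bit. -/
def flip (n : ℕ) (X : ℕ → Bool) : ℕ → Bool := Function.update X n (!X n)

lemma flip_flip (n : ℕ) (X : ℕ → Bool) : flip n (flip n X) = X := by
  funext m
  by_cases h : m = n
  · subst h; simp [flip]
  · simp [flip, h]

lemma measurable_flip (n : ℕ) : Measurable (flip n) := by
  rw [measurable_pi_iff]
  intro m
  by_cases h : m = n
  · subst h
    simp only [flip, Function.update_self]
    exact (measurable_of_countable (fun b : Bool => !b)).comp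
      (measurable_pi_apply (X := fun _ : ℕ => Bool) m)
  · simp only [flip, Function.update_of_ne h]
    exact measurable_pi_apply m

lemma mem_cyl {σ : List Bool} {X : ℕ → Bool} :
    X ∈ cyl σ ↔ ∀ i (h : i < σ.length), X i = σ[i] := by
  constructor
  · intro h i hi
    exact h ⟨i, hi⟩
  · intro h i
    exact h i i.2

lemma measurable_cyl (σ : List Bool) : MeasurableSet (cyl σ) := by
  have : cyl σ = ⋂ i : Fin σ.length, (fun X : ℕ → Bool => X i) ⁻¹' {σ.get i} := by
    ext X; simp [cyl]
  rw [this]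
  exact MeasurableSet.iInter fun i => measurable_pi_apply _ (measurableSet_singleton _)

lemma cyl_isPi : IsPiSystem (Set.range cyl) := by
  rintro _ ⟨σ, rfl⟩ _ ⟨τ, rfl⟩ ⟨X, hX1, hX2⟩
  rw [mem_cyl] at hX1 hX2
  rcases le_total σ.length τ.length with h | h
  · refine ⟨τ, Set.Subset.antisymm ?_ Set.inter_subset_right⟩
    intro Y hY
    refine ⟨?_, hY⟩
    rw [mem_cyl] at hY ⊢
    intro i hi
    rw [hY i (by omega), ← hX2 i (by omega), hX1 i hi]
  · refine ⟨σ, Set.Subset.antisymm ?_ Set.inter_subset_left⟩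
    intro Y hY
    refine ⟨hY, ?_⟩
    rw [mem_cyl] at hY ⊢
    intro i hi
    rw [hY i (by omega), ← hX1 i (by omega), hX2 i hi]

lemma cyl_generate : (inferInstance : MeasurableSpace (ℕ → Bool)) =
    MeasurableSpace.generateFrom (Set.range cyl) := by
  apply le_antisymm
  · refine iSup_le fun i => ?_
    rw [← measurable_iff_comap_le]
    apply @measurable_to_bool _ (MeasurableSpace.generateFrom (Set.range cyl))
    have : (fun X : ℕ → Bool => X i) ⁻¹' {true} =
        ⋃ σ ∈ {σ : List Bool | ∃ h : i < σ.length, σ[i] = true}, cyl σ := by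
      ext X
      simp only [Set.mem_preimage, Set.mem_singleton_iff, Set.mem_iUnion, Set.mem_ofPred_eq,
        exists_prop]
      constructor
      · intro h
        refine ⟨res X (i+1), ⟨by simp [res], by unfold res; rw [List.getElem_ofFn]; exact h⟩, ?_⟩
        rw [mem_cyl]
        intro j hj
        exact (List.getElem_ofFn (f := fun t : Fin (i+1) => X t) hj).symm
      · rintro ⟨σ, ⟨h, h2⟩, h3⟩
        rw [mem_cyl] at h3
        rw [h3 i h, h2]
    rw [this]
    exact MeasurableSet.biUnion (Set.to_countable _)
      fun σ _ => MeasurableSpace.measurableSet_generateFrom ⟨σ, rfl⟩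
  · apply MeasurableSpace.generateFrom_le
    rintro _ ⟨σ, rfl⟩
    exact measurable_cyl σ

lemma map_flip {μ : Measure (ℕ → Bool)} (hμ : IsCoinMeasure μ) (n : ℕ) :
    μ.map (flip n) = μ := by
  have hu : μ Set.univ = 1 := by
    have := hμ []
    have h2 : cyl [] = Set.univ := by ext X; simp [cyl]
    rw [h2] at this
    simpa using this
  have : IsFiniteMeasure μ := ⟨by rw [hu]; simp⟩
  symm
  refine ext_of_generate_finite _ cyl_generate cyl_isPi ?_ ?_
  · rintro _ ⟨σ, rfl⟩
    rw [Measure.map_apply (measurable_flip n) (measurable_cyl σ)]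
    have : flip n ⁻¹' cyl σ = cyl (σ.modify n not) := by
      ext X
      rw [Set.mem_preimage, mem_cyl, mem_cyl]
      simp only [List.length_modify, List.getElem_modify]
      refine forall_congr' fun i => forall_congr' fun hi => ?_
      by_cases h : i = n
      · subst h
        simp only [flip, Function.update_self, if_true]
        cases X i <;> cases σ[i] <;> simp
      · simp [flip, h, Ne.symm h]
    rw [this, hμ, hμ, List.length_modify]
  · rw [Measure.map_apply (measurable_flip n) MeasurableSet.univ, Set.preimage_univ]

lemma half_bound {μ : Measure (ℕ → Bool)} (hμ : IsCoinMeasure μ) (n : ℕ)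
    {S V : Set (ℕ → Bool)} (hS : MeasurableSet S) (hV : MeasurableSet V)
    (hd : ∀ X ∈ S, flip n X ∉ S) (hi : ∀ X ∈ V, flip n X ∈ V) :
    2 * μ (S ∩ V) ≤ μ V := by
  have h1 : μ (flip n ⁻¹' (S ∩ V)) = μ (S ∩ V) := by
    rw [← Measure.map_apply (measurable_flip n) (hS.inter hV), map_flip hμ n]
  have h2 : Disjoint (S ∩ V) (flip n ⁻¹' (S ∩ V)) := by
    rw [Set.disjoint_left]
    intro X hX hX2
    exact hd X hX.1 hX2.1
  calc 2 * μ (S ∩ V) = μ (S ∩ V) + μ (flip n ⁻¹' (S ∩ V)) := by rw [h1, two_mul]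
    _ = μ ((S ∩ V) ∪ flip n ⁻¹' (S ∩ V)) :=
        (measure_union h2 (measurable_flip n (hS.inter hV))).symm
    _ ≤ μ V := by
        apply measure_mono
        rintro X (hX | hX)
        · exact hX.2
        · have := hi _ hX.2
          rwa [flip_flip] at this

lemma null_of_auto {μ : Measure (ℕ → Bool)} (hμ : IsCoinMeasure μ)
    {S : Set (ℕ → Bool)} (hS : MeasurableSet S) (N : ℕ)
    (hd : ∀ n, N ≤ n → ∀ X ∈ S, flip n X ∉ S) : μ S = 0 := by
  have hu : μ Set.univ = 1 := by
    have := hμ []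
    have h2 : cyl [] = Set.univ := by ext X; simp [cyl]
    rw [h2] at this
    simpa using this
  have : IsFiniteMeasure μ := ⟨by rw [hu]; simp⟩
  have key : ∀ U : Set (ℕ → Bool), S ⊆ U → IsOpen U → 2 * μ S ≤ μ U := by
    intro U hSU hU
    let V : ℕ → Set (ℕ → Bool) := fun k => {X | PiNat.cylinder X k ⊆ U}
    have hVo : ∀ k, IsOpen (V k) := by
      intro k
      rw [isOpen_iff_forall_mem_open]
      intro X hX
      refine ⟨PiNat.cylinder X k, ?_, PiNat.isOpen_cylinder _ X k, PiNat.self_mem_cylinder X k⟩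
      intro Y hY
      have : PiNat.cylinder Y k = PiNat.cylinder X k := PiNat.mem_cylinder_iff_eq.1 hY
      change PiNat.cylinder Y k ⊆ U
      rw [this]; exact hX
    have hVm : Monotone V := by
      intro a b hab X hX
      exact (PiNat.cylinder_anti X hab).trans hX
    have hVU : ⋃ k, V k = U := by
      ext X
      rw [Set.mem_iUnion]
      constructor
      · rintro ⟨k, hk⟩
        exact hk (PiNat.self_mem_cylinder X k)
      · intro hX
        obtain ⟨v, ⟨Y, k, rfl⟩, h1, h2⟩ :=
          (PiNat.isTopologicalBasis_cylinders (fun _ : ℕ => Bool)).exists_subset_of_mem_open hX hU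
        refine ⟨k, ?_⟩
        have : PiNat.cylinder X k = PiNat.cylinder Y k := PiNat.mem_cylinder_iff_eq.1 h1
        change PiNat.cylinder X k ⊆ U
        rw [this]; exact h2
    have hSe : S = ⋃ k, S ∩ V k := by
      rw [← Set.inter_iUnion, hVU]
      exact (Set.inter_eq_left.2 hSU).symm
    have h1 : μ S = ⨆ k, μ (S ∩ V k) := by
      conv_lhs => rw [hSe]
      apply Monotone.measure_iUnion
      intro a b hab
      exact Set.inter_subset_inter_right _ (hVm hab)
    rw [h1, ENNReal.mul_iSup]
    refine iSup_le fun k => ?_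
    refine (half_bound hμ (max k N) hS (hVo k).measurableSet (hd _ (le_max_right _ _)) ?_).trans ?_
    · intro X hX
      have : PiNat.cylinder (flip (max k N) X) k = PiNat.cylinder X k := by
        apply PiNat.mem_cylinder_iff_eq.1
        intro i hi
        have : i ≠ max k N := by
          have := le_max_left k N
          omega
        simp [flip, this]
      change PiNat.cylinder _ k ⊆ U
      rw [this]; exact hX
    · apply measure_mono
      rw [← hVU]; exact Set.subset_iUnion V k
  have h2 : 2 * μ S ≤ μ S := by
    conv_rhs => rw [Set.measure_eq_iInf_isOpen S μ]
    exact le_iInf fun U => le_iInf fun h => le_iInf fun h' => key U h h'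
  by_contra h0
  have hfin : μ S ≠ ⊤ := measure_ne_top μ S
  have : μ S < 2 * μ S := by
    rw [two_mul]
    exact ENNReal.lt_add_right hfin h0
  exact absurd h2 (not_le.2 this)

lemma measurable_pi03 {C : Set (ℕ → Bool)} (hC : IsPi03 C) : MeasurableSet C := by
  obtain ⟨R, -, rfl⟩ := hC
  have : {A : ℕ → Bool | ∀ m, ∃ k, ∀ j, R m k (res A j) = true} =
      ⋂ m, ⋃ k, ⋂ j, (fun (A : ℕ → Bool) (i : Fin j) => A i) ⁻¹'
        {f | R m k (List.ofFn f) = true} := by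
    ext A
    simp [res]
  rw [this]
  refine MeasurableSet.iInter fun m => MeasurableSet.iUnion fun k => MeasurableSet.iInter fun j => ?_
  exact (measurable_pi_lambda _ fun i => measurable_pi_apply _) (Set.toFinite _).measurableSet


end Intro17
namespace Intro17
open Denumerable

/-- The list of elements of the `y`-th finite set. -/
def dlist (y : ℕ) : List ℕ := raise' (ofNat (List ℕ) y) 0

lemma mem_Dfin {y z : ℕ} : z ∈ Dfin y ↔ z ∈ dlist y := by
  have : Denumerable.ofNat (Finset ℕ) y =
      Finset.map (eqv ℕ).symm.toEmbedding (raise'Finset (ofNat (List ℕ) y) 0) := by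
    rfl
  unfold Dfin dlist
  rw [this]
  simp only [raise'Finset, Finset.coe_map, Equiv.coe_toEmbedding, Set.mem_image, Finset.mem_coe]
  constructor
  · rintro ⟨x, hx, rfl⟩
    exact hx
  · intro h
    exact ⟨z, h, rfl⟩

lemma raise_fold (l : List ℕ) : ∀ (n : ℕ) (acc : List ℕ),
    (l.foldl (fun (s : List ℕ × ℕ) m => (s.1 ++ [m + s.2], m + s.2 + 1)) (acc, n)).1
      = acc ++ raise' l n := by
  induction l with
  | nil => intro n acc; simp [raise']
  | cons a l ih => intro n acc; simp [raise', ih]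

lemma primrec_dlist : Primrec dlist := by
  have h0 : Primrec (fun y : ℕ => (ofNat (List ℕ) y)) := by
    have := (Primrec.decode (α := List ℕ))
    have h2 : (fun y : ℕ => (Encodable.decode y : Option (List ℕ))) =
        fun y => some (ofNat (List ℕ) y) := by
      funext y
      exact decode_eq_ofNat _ _
    exact Primrec.option_some_iff.1 (h2 ▸ this)
  have h1 : Primrec (fun y : ℕ => ((ofNat (List ℕ) y).foldl
      (fun (s : List ℕ × ℕ) m => (s.1 ++ [m + s.2], m + s.2 + 1)) (([] : List ℕ), 0)).1) := by
    apply Primrec.fst.comp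
    refine Primrec.list_foldl (h := fun _ (p : (List ℕ × ℕ) × ℕ) =>
      (p.1.1 ++ [p.2 + p.1.2], p.2 + p.1.2 + 1)) h0 (Primrec.const _) ?_
    have hs : Primrec (fun q : ℕ × ((List ℕ × ℕ) × ℕ) => q.2.2 + q.2.1.2) :=
      Primrec.nat_add.comp (Primrec.snd.comp Primrec.snd)
        (Primrec.snd.comp (Primrec.fst.comp Primrec.snd))
    exact Primrec.pair
      (Primrec.list_concat.comp (Primrec.fst.comp (Primrec.fst.comp Primrec.snd)) hs)
      (Primrec.succ.comp hs)
  refine h1.of_eq fun y => ?_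
  rw [raise_fold]; simp [dlist]

/-- A primitive recursive monotone enumeration. -/
structure Enum (W : Set ℕ) (w : ℕ → ℕ → Prop) : Prop where
  prim : PrimrecRel w
  mono : ∀ s t x, s ≤ t → w s x → w t x
  lim : ∀ x, x ∈ W ↔ ∃ s, w s x

lemma CE.enum {W : Set ℕ} (h : CE W) : ∃ w, Enum W w := by
  obtain ⟨f, hf, rfl⟩ := h
  obtain ⟨c, hc⟩ := Nat.Partrec.Code.exists_code.1 (Partrec.nat_iff.1 hf)
  refine ⟨fun s x => (Nat.Partrec.Code.evaln s c x).isSome = true, ?_, ?_, ?_⟩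
  · have h1 : Primrec (fun p : ℕ × ℕ => (Nat.Partrec.Code.evaln p.1 c p.2).isSome) :=
      Primrec.option_isSome.comp (Nat.Partrec.Code.primrec_evaln.comp
        ((Primrec.fst.pair (Primrec.const c)).pair Primrec.snd))
    exact Primrec.eq.comp h1 (Primrec.const true)
  · intro s t x hst h
    rw [Option.isSome_iff_exists] at h ⊢
    obtain ⟨a, ha⟩ := h
    exact ⟨a, Nat.Partrec.Code.evaln_mono hst ha⟩
  · intro x
    rw [PFun.mem_dom, ← hc]
    constructor
    · rintro ⟨y, hy⟩
      obtain ⟨k, hk⟩ := Nat.Partrec.Code.evaln_complete.1 hy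
      exact ⟨k, Option.isSome_iff_exists.2 ⟨y, hk⟩⟩
    · rintro ⟨s, hs⟩
      obtain ⟨y, hy⟩ := Option.isSome_iff_exists.1 hs
      exact ⟨y, Nat.Partrec.Code.evaln_sound hy⟩

/-- Finite approximations of sets depending on a parameter `n` and an oracle `X`. -/
structure Approx (Y : ℕ → (ℕ → Bool) → Set ℕ) (Q : ℕ → ℕ → List Bool → Prop) : Prop where
  prim : PrimrecPred (fun p : ℕ × ℕ × List Bool => Q p.1 p.2.1 p.2.2)
  mono : ∀ n x X j k, j ≤ k → Q n x (res X j) → Q n x (res X k)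
  lim : ∀ n X x, x ∈ Y n X ↔ ∃ k, Q n x (res X k)

/-- Approximation of an enumeration operator applied to an approximated set. -/
def opA (w : ℕ → ℕ → Prop) (Q : ℕ → ℕ → List Bool → Prop) (n x : ℕ) (σ : List Bool) : Prop :=
  ∃ y < σ.length, w σ.length (Nat.pair x y) ∧ ∀ z ∈ dlist y, Q n z σ

@[simp] lemma length_res (X : ℕ → Bool) (k : ℕ) : (res X k).length = k := by simp [res]

lemma bdd_stage {X : ℕ → Bool} {n : ℕ} {Q : ℕ → ℕ → List Bool → Prop}
    (mono : ∀ n x X j k, j ≤ k → Q n x (res X j) → Q n x (res X k)) (l : List ℕ)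
    (h : ∀ z ∈ l, ∃ k, Q n z (res X k)) : ∃ k, ∀ z ∈ l, Q n z (res X k) := by
  induction l with
  | nil => exact ⟨0, by simp⟩
  | cons a l ih =>
    obtain ⟨k, hk⟩ := ih fun z hz => h z (List.mem_cons_of_mem _ hz)
    obtain ⟨k', hk'⟩ := h a List.mem_cons_self
    refine ⟨max k k', ?_⟩
    intro z hz
    rcases List.mem_cons.1 hz with rfl | hz
    · exact mono _ _ _ _ _ (le_max_right _ _) hk'
    · exact mono _ _ _ _ _ (le_max_left _ _) (hk z hz)

lemma ex_lt {β : Type*} [Primcodable β] {R : ℕ → β → Prop} (h : PrimrecRel R) :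
    PrimrecRel (fun (n : ℕ) (b : β) => ∃ x < n, R x b) :=
  (h.exists_mem_list.comp (Primrec.list_range.comp Primrec.fst) Primrec.snd).of_eq
    (fun p => by simp)

lemma all_lt {β : Type*} [Primcodable β] {R : ℕ → β → Prop} (h : PrimrecRel R) :
    PrimrecRel (fun (n : ℕ) (b : β) => ∀ x < n, R x b) :=
  (h.forall_mem_list.comp (Primrec.list_range.comp Primrec.fst) Primrec.snd).of_eq
    (fun p => by simp)

lemma Approx.op {W : Set ℕ} {w : ℕ → ℕ → Prop} (hw : Enum W w)
    {Y : ℕ → (ℕ → Bool) → Set ℕ} {Q : ℕ → ℕ → List Bool → Prop} (hQ : Approx Y Q) :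
    Approx (fun n X => enumOp W (Y n X)) (opA w Q) where
  prim := by
    have e1 : PrimrecRel (fun (z : ℕ) (p : ℕ × ℕ × List Bool) => Q p.1 z p.2.2) :=
      hQ.prim.comp ((Primrec.fst.comp Primrec.snd).pair
        (Primrec.fst.pair (Primrec.snd.comp (Primrec.snd.comp Primrec.snd))))
    have e2 : PrimrecRel (fun (y : ℕ) (p : ℕ × ℕ × List Bool) => ∀ z ∈ dlist y, Q p.1 z p.2.2) :=
      e1.forall_mem_list.comp (primrec_dlist.comp Primrec.fst) Primrec.snd
    have l : Primrec (fun q : ℕ × (ℕ × ℕ × List Bool) => q.2.2.2.length) :=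
      Primrec.list_length.comp (Primrec.snd.comp (Primrec.snd.comp Primrec.snd))
    have e3 : PrimrecRel (fun (y : ℕ) (p : ℕ × ℕ × List Bool) =>
        w p.2.2.length (Nat.pair p.2.1 y)) :=
      hw.prim.comp l (Primrec₂.natPair.comp (Primrec.fst.comp (Primrec.snd.comp Primrec.snd))
        Primrec.fst)
    have e4 : PrimrecRel (fun (y : ℕ) (p : ℕ × ℕ × List Bool) =>
        w p.2.2.length (Nat.pair p.2.1 y) ∧ ∀ z ∈ dlist y, Q p.1 z p.2.2) :=
      PrimrecPred.and e3 e2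
    exact PrimrecRel.comp (f := fun q : ℕ × ℕ × List Bool => q.2.2.length) (g := fun q => q)
      (ex_lt e4) (Primrec.list_length.comp (Primrec.snd.comp Primrec.snd)) Primrec.id
  mono := by
    rintro n x X j k hjk ⟨y, hy, h1, h2⟩
    rw [length_res] at hy h1
    refine ⟨y, by rw [length_res]; omega, ?_, ?_⟩
    · rw [length_res]; exact hw.mono _ _ _ hjk h1
    · exact fun z hz => hQ.mono _ _ _ _ _ hjk (h2 z hz)
  lim := by
    intro n X x
    constructor
    · rintro ⟨y, hy, h⟩
      obtain ⟨s, hs⟩ := (hw.lim _).1 hy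
      obtain ⟨k, hk⟩ := bdd_stage (X := X) (n := n) hQ.mono (dlist y)
        fun z hz => (hQ.lim _ _ _).1 (h (mem_Dfin.2 hz))
      refine ⟨max (y+1) (max s k), y, ?_, ?_, ?_⟩
      · rw [length_res]; omega
      · rw [length_res]; exact hw.mono _ _ _ (by omega) hs
      · exact fun z hz => hQ.mono _ _ _ _ _ (by omega) (hk z hz)
    · rintro ⟨k, y, hy, h1, h2⟩
      exact ⟨y, (hw.lim _).2 ⟨_, h1⟩, fun z hz => (hQ.lim _ _ _).2 ⟨k, h2 z (mem_Dfin.1 hz)⟩⟩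

lemma prim_mem (D : Finset ℕ) : PrimrecPred (fun n : ℕ => n ∈ D) := by
  have : PrimrecRel (fun (L : List ℕ) (n : ℕ) => ∃ a ∈ L, a = n) :=
    PrimrecRel.exists_mem_list (R := fun a n : ℕ => a = n) Primrec.eq
  exact (this.comp (Primrec.const D.toList) Primrec.id).of_eq fun n => by simp

lemma res_getD (X : ℕ → Bool) (k z : ℕ) : (res X k).getD z false = true ↔ z < k ∧ X z = true := by
  rw [List.getD_eq_getElem?_getD]
  by_cases h : z < k
  · simp [res, h]
  · simp [res, h]

lemma approx_base (D : Finset ℕ) :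
    Approx (fun n X => toSet X \ ↑(insert n D))
      (fun n z σ => σ.getD z false = true ∧ ¬ (z = n ∨ z ∈ D)) where
  prim := by
    refine PrimrecPred.and (Primrec.eq.comp ((Primrec.list_getD false).comp
      (Primrec.snd.comp Primrec.snd) (Primrec.fst.comp Primrec.snd)) (Primrec.const true)) ?_
    exact ((Primrec.eq.comp (Primrec.fst.comp Primrec.snd) Primrec.fst).or
      ((prim_mem D).comp (Primrec.fst.comp Primrec.snd))).not
  mono := by
    intro n x X j k hjk h
    rw [res_getD] at h ⊢
    exact ⟨⟨by omega, h.1.2⟩, h.2⟩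
  lim := by
    intro n X x
    simp only [res_getD, Set.mem_sdiff, toSet, Set.mem_ofPred_eq, Finset.coe_insert,
      Set.mem_insert_iff, Finset.mem_coe]
    constructor
    · rintro ⟨h1, h2⟩
      exact ⟨x+1, ⟨by omega, h1⟩, h2⟩
    · rintro ⟨k, h1, h2⟩
      exact ⟨h1.2, h2⟩

lemma Approx.union (F : Finset ℕ) {Y : ℕ → (ℕ → Bool) → Set ℕ} {Q : ℕ → ℕ → List Bool → Prop}
    (hQ : Approx Y Q) : Approx (fun n X => ↑F ∪ Y n X) (fun n z σ => z ∈ F ∨ Q n z σ) where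
  prim := ((prim_mem F).comp (Primrec.fst.comp Primrec.snd)).or hQ.prim
  mono := by
    rintro n x X j k hjk (h | h)
    · exact Or.inl h
    · exact Or.inr (hQ.mono _ _ _ _ _ hjk h)
  lim := by
    intro n X x
    rw [Set.mem_union, hQ.lim, exists_or, exists_const]
    rfl

/-- The autoreducibility class is `Π⁰₃`. -/
lemma pi03_class (D : Finset ℕ) {T P : ℕ → (ℕ → Bool) → Set ℕ}
    {t p : ℕ → ℕ → List Bool → Prop} (hT : Approx T t) (hP : Approx P p) :
    IsPi03 {X | ∀ n, n ∉ D → (X n = true ↔ (n ∈ P n X ∨ (T n X).Finite))} := by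
  classical
  let R1 : ℕ → ℕ → List Bool → Prop := fun n k σ =>
    ¬ σ.getD n false = true ∨ p n n σ ∨ ∀ x < σ.length, ¬ (k ≤ x ∧ t n x σ)
  let R2 : ℕ → ℕ → List Bool → Prop := fun n b σ =>
    σ.getD n false = true ∨ (¬ p n n σ ∧ ∃ x < σ.length, b ≤ x ∧ t n x σ)
  let R : ℕ → ℕ → List Bool → Prop := fun m k σ =>
    m.unpair.1 ∈ D ∨ σ.length < k ∨ (R1 m.unpair.1 k σ ∧ R2 m.unpair.1 m.unpair.2 σ)
  refine ⟨fun m k σ => decide (R m k σ), ?_, ?_⟩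
  · apply Primrec.to_comp
    have hg : PrimrecPred (fun q : ℕ × ℕ × List Bool => q.2.2.getD q.1 false = true) :=
      Primrec.eq.comp ((Primrec.list_getD false).comp
        (Primrec.snd.comp Primrec.snd) Primrec.fst) (Primrec.const true)
    have hp : PrimrecPred (fun q : ℕ × ℕ × List Bool => p q.1 q.1 q.2.2) :=
      hP.prim.comp (Primrec.fst.pair (Primrec.fst.pair (Primrec.snd.comp Primrec.snd)))
    have ht : PrimrecRel (fun (x : ℕ) (q : ℕ × ℕ × List Bool) => q.2.1 ≤ x ∧ t q.1 x q.2.2) :=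
      PrimrecPred.and (Primrec.nat_le.comp (Primrec.fst.comp (Primrec.snd.comp Primrec.snd))
        Primrec.fst)
        (hT.prim.comp ((Primrec.fst.comp Primrec.snd).pair
        (Primrec.fst.pair (Primrec.snd.comp (Primrec.snd.comp Primrec.snd)))))
    have hl : Primrec (fun q : ℕ × ℕ × List Bool => q.2.2.length) :=
      Primrec.list_length.comp (Primrec.snd.comp Primrec.snd)
    have h1 : PrimrecPred (fun q : ℕ × ℕ × List Bool => R1 q.1 q.2.1 q.2.2) :=
      hg.not.or (hp.or (PrimrecRel.comp (g := fun q : ℕ × ℕ × List Bool => q) (all_lt ht.not) hl Primrec.id))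
    have h2 : PrimrecPred (fun q : ℕ × ℕ × List Bool => R2 q.1 q.2.1 q.2.2) :=
      hg.or (hp.not.and (PrimrecRel.comp (g := fun q : ℕ × ℕ × List Bool => q) (ex_lt ht) hl Primrec.id))
    have hu1 : Primrec (fun q : ℕ × ℕ × List Bool => q.1.unpair.1) :=
      Primrec.fst.comp (Primrec.unpair.comp Primrec.fst)
    have hu2 : Primrec (fun q : ℕ × ℕ × List Bool => q.1.unpair.2) :=
      Primrec.snd.comp (Primrec.unpair.comp Primrec.fst)
    have hR : PrimrecPred (fun q : ℕ × ℕ × List Bool => R q.1 q.2.1 q.2.2) :=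
      ((prim_mem D).comp hu1).or ((Primrec.nat_lt.comp hl (Primrec.fst.comp Primrec.snd)).or
        ((h1.comp (hu1.pair Primrec.snd)).and
          (h2.comp (hu1.pair (hu2.pair (Primrec.snd.comp Primrec.snd))))))
    exact hR.decide
  · ext X
    simp only [Set.mem_ofPred_eq, decide_eq_true_eq]
    constructor
    · intro h m
      by_cases hD : m.unpair.1 ∈ D
      · exact ⟨0, fun j => Or.inl hD⟩
      have hn := h _ hD
      set n := m.unpair.1
      set b := m.unpair.2
      by_cases hX : X n = true
      · rcases hn.1 hX with h1 | h1
        · obtain ⟨k, hk⟩ := (hP.lim _ _ _).1 h1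
          refine ⟨max k (n+1), fun j => Or.inr ?_⟩
          rw [length_res]
          by_cases hj : j < max k (n+1)
          · exact Or.inl hj
          · refine Or.inr ⟨Or.inr (Or.inl ?_), Or.inl ?_⟩
            · exact hP.mono _ _ _ _ _ (by omega) hk
            · rw [res_getD]; exact ⟨by omega, hX⟩
        · obtain ⟨k, hk⟩ := h1.bddAbove
          refine ⟨max (k+1) (n+1), fun j => Or.inr ?_⟩
          rw [length_res]
          by_cases hj : j < max (k+1) (n+1)
          · exact Or.inl hj
          · refine Or.inr ⟨Or.inr (Or.inr ?_), Or.inl ?_⟩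
            · rintro x hx ⟨hx2, hx3⟩
              have := hk ((hT.lim _ _ _).2 ⟨_, hx3⟩)
              omega
            · rw [res_getD]; exact ⟨by omega, hX⟩
      · have h1 : ¬ (n ∈ P n X ∨ (T n X).Finite) := fun h => hX (hn.2 h)
        push Not at h1
        obtain ⟨x, hx, hbx⟩ := h1.2.exists_gt b
        obtain ⟨k, hk⟩ := (hT.lim _ _ _).1 hx
        refine ⟨max k (x+1), fun j => Or.inr ?_⟩
        rw [length_res]
        by_cases hj : j < max k (x+1)
        · exact Or.inl hj
        · refine Or.inr ⟨Or.inl ?_, Or.inr ⟨?_, x, ?_, by omega, ?_⟩⟩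
          · rw [res_getD]; exact fun h => hX h.2
          · exact fun h => h1.1 ((hP.lim _ _ _).2 ⟨_, h⟩)
          · rw [length_res]; omega
          · exact hT.mono _ _ _ _ _ (by omega) hk
    · intro h n hD
      constructor
      · intro hX
        by_contra hcon
        push Not at hcon
        obtain ⟨k, hk⟩ := h (Nat.pair n 0)
        obtain ⟨x, hx, hkx⟩ := hcon.2.exists_gt k
        obtain ⟨s, hs⟩ := (hT.lim _ _ _).1 hx
        rcases hk (max (max k s) (max (n+1) (x+1))) with h1 | h1 | ⟨h1, -⟩
        · rw [Nat.unpair_pair] at h1; exact hD h1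
        · rw [length_res] at h1; omega
        · rw [Nat.unpair_pair] at h1
          rcases h1 with h1 | h1 | h1
          · rw [res_getD] at h1; exact h1 ⟨by omega, hX⟩
          · exact hcon.1 ((hP.lim _ _ _).2 ⟨_, h1⟩)
          · exact h1 x (by rw [length_res]; omega) ⟨by omega, hT.mono _ _ _ _ _ (by omega) hs⟩
      · intro hor
        by_contra hX
        rcases hor with h1 | h1
        · obtain ⟨s, hs⟩ := (hP.lim _ _ _).1 h1
          obtain ⟨k, hk⟩ := h (Nat.pair n 0)
          rcases hk (max k s) with h2 | h2 | ⟨-, h2⟩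
          · rw [Nat.unpair_pair] at h2; exact hD h2
          · rw [length_res] at h2; omega
          · rw [Nat.unpair_pair] at h2
            rcases h2 with h2 | h2
            · rw [res_getD] at h2; exact hX h2.2
            · exact h2.1 (hP.mono _ _ _ _ _ (by omega) hs)
        · obtain ⟨b, hb⟩ := h1.bddAbove
          obtain ⟨k, hk⟩ := h (Nat.pair n (b+1))
          rcases hk k with h2 | h2 | ⟨-, h2⟩
          · rw [Nat.unpair_pair] at h2; exact hD h2
          · rw [length_res] at h2; omega
          · rw [Nat.unpair_pair] at h2
            rcases h2 with h2 | ⟨-, x, hx, hbx, hx2⟩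
            · rw [res_getD] at h2; exact hX h2.2
            · have := hb ((hT.lim _ _ _).2 ⟨_, hx2⟩)
              simp only at hbx
              omega


end Intro17
namespace Intro17

lemma enumOp_mono (W : Set ℕ) {X Y : Set ℕ} (h : X ⊆ Y) : enumOp W X ⊆ enumOp W Y := by
  rintro x ⟨y, hy, hD⟩
  exact ⟨y, hy, hD.trans h⟩

lemma enumOp_finite {W X : Set ℕ} {x : ℕ} (h : x ∈ enumOp W X) :
    ∃ G : Finset ℕ, ↑G ⊆ X ∧ x ∈ enumOp W ↑G := by
  obtain ⟨y, hy, hD⟩ := h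
  exact ⟨Denumerable.ofNat (Finset ℕ) y, hD, y, hy, subset_rfl⟩

/-- The diagonalization step. -/
lemma step {μ : Measure (ℕ → Bool)} (hμ : IsCoinMeasure μ) {A : ℕ → Bool} (hA : Weak3Random μ A)
    {B Φ Θ : Set ℕ} (hΦ : CE Φ) (hΘ : CE Θ) (hAB : toSet A = enumOp Φ B)
    (hBA : B = enumOp Θ (toSet A)) {Γ : Set ℕ} (hΓ : CE Γ) (F D : Finset ℕ)
    (hF : ↑F ⊆ B) (hinf : (enumOp Θ (toSet A \ ↑D)).Infinite) :
    ∃ F' D' : Finset ℕ, ↑F' ⊆ B ∧ (enumOp Θ (toSet A \ ↑D')).Infinite ∧ F ⊆ F' ∧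
      (F' : Set ℕ) ⊆ ↑F ∪ enumOp Θ (toSet A \ ↑D) ∧ D ⊆ D' ∧ F.card < F'.card ∧
      ∀ C : Set ℕ, ↑F' ⊆ C → C ⊆ ↑F' ∪ enumOp Θ (toSet A \ ↑D') → enumOp Γ C ≠ B := by
  classical
  have hsub : ∀ E : Finset ℕ, enumOp Θ (toSet A \ ↑E) ⊆ B := by
    intro E
    rw [hBA]
    exact enumOp_mono _ Set.sdiff_subset
  by_cases c1 : ∃ G : Finset ℕ, (G : Set ℕ) ⊆ ↑F ∪ enumOp Θ (toSet A \ ↑D) ∧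
      ¬ enumOp Γ (↑F ∪ ↑G) ⊆ B
  · obtain ⟨G, hG, hGB⟩ := c1
    obtain ⟨x, hx, hxF⟩ := hinf.exists_notMem_finset (F ∪ G)
    refine ⟨insert x (F ∪ G), D, ?_, hinf, ?_, ?_, subset_rfl, ?_, ?_⟩
    · intro z hz
      simp only [Finset.coe_insert, Finset.coe_union, Set.mem_insert_iff, Set.mem_union] at hz
      rcases hz with rfl | hz | hz
      · exact hsub _ hx
      · exact hF hz
      · rcases hG hz with h | h
        · exact hF h
        · exact hsub _ h
    · intro z hz; simp [hz]
    · intro z hz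
      simp only [Finset.coe_insert, Finset.coe_union, Set.mem_insert_iff, Set.mem_union] at hz
      rcases hz with rfl | hz | hz
      · exact Or.inr hx
      · exact Or.inl hz
      · exact hG hz
    · rw [Finset.card_insert_of_notMem hxF]
      exact Nat.lt_succ_of_le (Finset.card_le_card Finset.subset_union_left)
    · intro C hC _ he
      apply hGB
      rw [← he]
      apply enumOp_mono
      refine Set.Subset.trans ?_ hC
      simp only [Finset.coe_insert, Finset.coe_union]
      exact Set.subset_insert _ _
  push Not at c1
  have hΓB : enumOp Γ (↑F ∪ enumOp Θ (toSet A \ ↑D)) ⊆ B := by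
    intro x hx
    obtain ⟨G, hG, hxG⟩ := enumOp_finite hx
    exact c1 G hG (enumOp_mono _ Set.subset_union_right hxG)
  by_cases c2 : ∃ n, (enumOp Θ (toSet A \ ↑(insert n D))).Infinite ∧
      enumOp Γ (↑F ∪ enumOp Θ (toSet A \ ↑(insert n D))) ≠ B
  · obtain ⟨n, hn, hne⟩ := c2
    have hs : enumOp Θ (toSet A \ ↑(insert n D)) ⊆ enumOp Θ (toSet A \ ↑D) := by
      apply enumOp_mono
      apply Set.sdiff_subset_sdiff_right
      exact_mod_cast Finset.subset_insert n D
    obtain ⟨x, hx, hxF⟩ := hn.exists_notMem_finset F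
    refine ⟨insert x F, insert n D, ?_, hn, Finset.subset_insert _ _, ?_,
      Finset.subset_insert _ _, ?_, ?_⟩
    · intro z hz
      simp only [Finset.coe_insert, Set.mem_insert_iff] at hz
      rcases hz with rfl | hz
      · exact hsub _ hx
      · exact hF hz
    · intro z hz
      simp only [Finset.coe_insert, Set.mem_insert_iff] at hz
      rcases hz with rfl | hz
      · exact Or.inr (hs hx)
      · exact Or.inl hz
    · rw [Finset.card_insert_of_notMem hxF]; omega
    · intro C _ hC he
      have h1 : C ⊆ ↑F ∪ enumOp Θ (toSet A \ ↑(insert n D)) := by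
        refine hC.trans ?_
        rintro z (hz | hz)
        · simp only [Finset.coe_insert x F, Set.mem_insert_iff] at hz
          rcases hz with rfl | hz
          · exact Or.inr hx
          · exact Or.inl hz
        · exact Or.inr hz
      apply hne
      apply Set.Subset.antisymm
      · exact (enumOp_mono _ (Set.union_subset_union_right _ hs)).trans hΓB
      · rw [← he]; exact enumOp_mono _ h1
  exfalso
  push Not at c2
  obtain ⟨wΦ, hwΦ⟩ := CE.enum hΦ
  obtain ⟨wΘ, hwΘ⟩ := CE.enum hΘ
  obtain ⟨wΓ, hwΓ⟩ := CE.enum hΓ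
  have aT := Approx.op hwΘ (approx_base D)
  have aP := Approx.op hwΦ (Approx.op hwΓ (Approx.union F aT))
  have hpi := pi03_class D aT aP
  refine hA _ hpi ?_ ?_
  · refine null_of_auto hμ (measurable_pi03 hpi) (D.sup id + 1) ?_
    intro n hn X hX hX2
    have hnD : n ∉ D := by
      intro h
      have : n ≤ D.sup id := Finset.le_sup (f := id) h
      omega
    have e : toSet (flip n X) \ ↑(insert n D) = toSet X \ ↑(insert n D) := by
      ext z
      by_cases hz : z = n
      · simp [hz]
      · simp [toSet, flip, hz]
    have h1 := hX n hnD
    have h2 := hX2 n hnD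
    simp only [e] at h1 h2
    rw [← h1] at h2
    simp [flip] at h2
  · intro n hnD
    constructor
    · intro hn
      by_cases hf : (enumOp Θ (toSet A \ ↑(insert n D))).Finite
      · exact Or.inr hf
      · left
        change n ∈ enumOp Φ (enumOp Γ (↑F ∪ enumOp Θ (toSet A \ ↑(insert n D))))
        rw [c2 n hf, ← hAB]
        exact hn
    · intro hor
      by_contra hn
      have e : toSet A \ ↑(insert n D) = toSet A \ ↑D := by
        ext z
        by_cases hz : z = n
        · simp [hz, toSet, hn]
        · simp [hz]
      simp only [e] at hor
      rcases hor with h | h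
      · apply hn
        have : n ∈ enumOp Φ B := enumOp_mono _ hΓB h
        rw [← hAB] at this
        exact this
      · exact hinf h

end Intro17

/-- No weakly 3-random set has introenumerable enumeration degree. -/
theorem stmt_17 (μ : Measure (ℕ → Bool)) (hμ : IsCoinMeasure μ)
    (A : ℕ → Bool) (h : Weak3Random μ A) :
    ¬ ∃ B : Set ℕ, EnumEquiv (toSet A) B ∧ Introenum B := by
  rintro ⟨B, ⟨⟨Φ, hΦ, hAB⟩, ⟨Θ, hΘ, hBA⟩⟩, hBinf, hB⟩
  let V : ℕ → Set ℕ := fun i => (Nat.Partrec.Code.eval (Denumerable.ofNat Nat.Partrec.Code i)).Dom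
  have hV : ∀ i, CE (V i) := fun i =>
    ⟨_, Partrec.nat_iff.2 (Nat.Partrec.Code.exists_code.2 ⟨_, rfl⟩), rfl⟩
  have hVs : ∀ W : Set ℕ, CE W → ∃ i, V i = W := by
    rintro W ⟨f, hf, rfl⟩
    obtain ⟨c, hc⟩ := Nat.Partrec.Code.exists_code.1 (Partrec.nat_iff.1 hf)
    refine ⟨Encodable.encode c, ?_⟩
    simp only [V, Denumerable.ofNat_encode, hc]
  let I : Type := {q : Finset ℕ × Finset ℕ //
    (q.1 : Set ℕ) ⊆ B ∧ (enumOp Θ (toSet A \ ↑q.2)).Infinite}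
  have st : ∀ (i : ℕ) (q : I), ∃ q' : I, q.1.1 ⊆ q'.1.1 ∧
      (q'.1.1 : Set ℕ) ⊆ ↑q.1.1 ∪ enumOp Θ (toSet A \ ↑q.1.2) ∧ q.1.2 ⊆ q'.1.2 ∧
      q.1.1.card < q'.1.1.card ∧
      ∀ C : Set ℕ, ↑q'.1.1 ⊆ C → C ⊆ ↑q'.1.1 ∪ enumOp Θ (toSet A \ ↑q'.1.2) →
        enumOp (V i) C ≠ B := by
    rintro i ⟨⟨F, D⟩, hF, hD⟩
    obtain ⟨F', D', h1, h2, h3⟩ := Intro17.step hμ h hΦ hΘ hAB hBA (hV i) F D hF hD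
    exact ⟨⟨⟨F', D'⟩, h1, h2⟩, h3⟩
  choose nxt n1 n2 n3 n4 n5 using st
  let q0 : I := ⟨(∅, ∅), by simp, by simpa [← hBA] using hBinf⟩
  let s : ℕ → I := fun i => Nat.rec q0 (fun i q => nxt i q) i
  have hs : ∀ i, s (i+1) = nxt i (s i) := fun i => rfl
  have mono : ∀ i j, i ≤ j → (s i).1.1 ⊆ (s j).1.1 := by
    intro i j hij
    induction j, hij using Nat.le_induction with
    | base => exact subset_rfl
    | succ j _ ih => exact ih.trans (n1 j (s j))
  have monoD : ∀ i j, i ≤ j → (s i).1.2 ⊆ (s j).1.2 := by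
    intro i j hij
    induction j, hij using Nat.le_induction with
    | base => exact subset_rfl
    | succ j _ ih => exact ih.trans (n3 j (s j))
  have up : ∀ i j, i ≤ j →
      ((s j).1.1 : Set ℕ) ⊆ ↑(s i).1.1 ∪ enumOp Θ (toSet A \ ↑(s i).1.2) := by
    intro i j hij
    induction j, hij using Nat.le_induction with
    | base => exact Set.subset_union_left
    | succ j hj ih =>
      refine (n2 j (s j)).trans (Set.union_subset ih ?_)
      refine Set.Subset.trans ?_ Set.subset_union_right
      apply Intro17.enumOp_mono
      apply Set.sdiff_subset_sdiff_right
      exact_mod_cast monoD i j hj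
  have card : ∀ i, i ≤ (s i).1.1.card := by
    intro i
    induction i with
    | zero => exact Nat.zero_le _
    | succ i ih => exact Nat.succ_le_of_lt (lt_of_le_of_lt ih (n4 i (s i)))
  let C : Set ℕ := ⋃ i, ((s i).1.1 : Set ℕ)
  have hCB : C ⊆ B := Set.iUnion_subset fun i => (s i).2.1
  have hCinf : C.Infinite := by
    intro hfin
    have h1 : (s (hfin.toFinset.card + 1)).1.1 ⊆ hfin.toFinset := by
      intro x hx
      rw [Set.Finite.mem_toFinset]
      exact Set.mem_iUnion.2 ⟨hfin.toFinset.card + 1, Finset.mem_coe.2 hx⟩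
    have h2 := Finset.card_le_card h1
    have h3 := card (hfin.toFinset.card + 1)
    omega
  obtain ⟨W, hW, hWC⟩ := hB C hCB hCinf
  obtain ⟨i, rfl⟩ := hVs W hW
  refine n5 i (s i) C ?_ ?_ hWC
  · exact Set.subset_iUnion (fun i => ((s i).1.1 : Set ℕ)) (i+1)
  · refine Set.iUnion_subset fun j => ?_
    rcases le_total j (i+1) with hj | hj
    · refine Set.Subset.trans ?_ Set.subset_union_left
      exact_mod_cast mono j (i+1) hj
    · exact up (i+1) j hj
end
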